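/- Let n ≥ 2 and let B ⊂ ℝ^{n+1} be a convex body containing the origin in its interior. If all hyperplane sections of B through the origin are affinely equivalent to one another (for any two n-dimensional linear subspaces H₁, H₂ of ℝ^{n+1} there is a bijective affine map of ℝ^{n+1} carrying B ∩ H₁ onto B ∩ H₂), then every hyperplane section of B through the origin is centrally symmetric, i.e., for every n-dimensional linear subspace H there is a point c ∈ H such that B ∩ H = 2c - (B ∩ H). -/

import Mathlib

open Metric

section Auxiliary

open MeasureTheory
open scoped RealInnerProductSpace ENNReal

theorem measure_ext_of_inner_pow_moments {E : Type*} [NormedAddCommGroup E]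
    [InnerProductSpace ℝ E] [FiniteDimensional ℝ E] [MeasurableSpace E] [BorelSpace E]
    {μ ν : Measure E} [IsFiniteMeasure μ] [IsFiniteMeasure ν] (R : ℝ)
    (hμ : ∀ᵐ y ∂μ, ‖y‖ ≤ R) (hν : ∀ᵐ y ∂ν, ‖y‖ ≤ R)
    (h : ∀ (ξ : E) (k : ℕ), ∫ y, ⟪y, ξ⟫ ^ k ∂μ = ∫ y, ⟪y, ξ⟫ ^ k ∂ν) : μ = ν := by
  have key : ∀ (ρ : Measure E) [IsFiniteMeasure ρ], (∀ᵐ y ∂ρ, ‖y‖ ≤ R) → ∀ ξ : E,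
      HasSum (fun k : ℕ => (Complex.I ^ k / (k.factorial : ℂ)) * ((∫ y, ⟪y, ξ⟫ ^ k ∂ρ : ℝ) : ℂ))
        (charFun ρ ξ) := by
    intro ρ _ hρ ξ
    have := hasSum_integral_of_dominated_convergence (μ := ρ)
      (F := fun (k : ℕ) y => (Complex.I ^ k / (k.factorial : ℂ)) * ((⟪y, ξ⟫ ^ k : ℝ) : ℂ))
      (f := fun y => Complex.exp (⟪y, ξ⟫ * Complex.I))
      (fun k _ => (R * ‖ξ‖) ^ k / (k.factorial : ℝ)) ?_ ?_ ?_ ?_ ?_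
    · rw [charFun_apply]
      simpa only [integral_const_mul, integral_complex_ofReal] using this
    · intro k
      exact (by fun_prop : Continuous _).aestronglyMeasurable
    · intro k
      filter_upwards [hρ] with y hy
      have h1 : |⟪y, ξ⟫| ≤ R * ‖ξ‖ := (abs_real_inner_le_norm y ξ).trans (by gcongr)
      simp only [norm_mul, norm_div, norm_pow, Complex.norm_I, one_pow, Complex.norm_natCast,
        Complex.norm_real, Real.norm_eq_abs]
      rw [one_div, div_eq_inv_mul]
      gcongr
    · exact Filter.Eventually.of_forall fun _ => Real.summable_pow_div_factorial _
    · exact integrable_const _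
    · refine Filter.Eventually.of_forall fun y => ?_
      have := NormedSpace.expSeries_div_hasSum_exp ((⟪y, ξ⟫ : ℂ) * Complex.I)
      rw [← Complex.exp_eq_exp_ℂ] at this
      have e : ∀ k : ℕ, Complex.I ^ k / (k.factorial : ℂ) * ((⟪y, ξ⟫ ^ k : ℝ) : ℂ) =
          ((⟪y, ξ⟫ : ℂ) * Complex.I) ^ k / k.factorial := fun k => by push_cast; ring
      simpa only [e] using this
  refine Measure.ext_of_charFun (funext fun ξ => ?_)
  refine (key μ hμ ξ).unique ?_
  simpa only [h] using key ν hν ξ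

theorem exists_map_withDensity_abs_det_eq_withDensity_enat {E : Type*} [NormedAddCommGroup E]
    [NormedSpace ℝ E] [FiniteDimensional ℝ E] [MeasurableSpace E] [BorelSpace E]
    (μ : Measure E) [μ.IsAddHaarMeasure] {V : E → E} {V' : E → E →L[ℝ] E} {A : Set E}
    (hA : MeasurableSet A) (hV : ∀ x ∈ A, HasStrictFDerivAt V (V' x) x)
    (hdet : ∀ x ∈ A, (V' x).det ≠ 0) :
    ∃ k : E → ℕ∞, (Measurable fun y => (k y : ℝ≥0∞)) ∧
      Measure.map V ((μ.restrict A).withDensity fun x => ENNReal.ofReal |(V' x).det|) =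
        μ.withDensity fun y => (k y : ℝ≥0∞) := by
  have hloc : ∀ x, ∃ U : Set E, IsOpen U ∧ (x ∈ A → x ∈ U) ∧ Set.InjOn V U := by
    intro x
    by_cases hx : x ∈ A
    · have h : HasStrictFDerivAt V
          ((V' x).toContinuousLinearEquivOfDetNeZero (hdet x hx) : E →L[ℝ] E) x := hV x hx
      exact ⟨_, (h.toOpenPartialHomeomorph V).open_source,
        fun _ => h.mem_toOpenPartialHomeomorph_source, (h.toOpenPartialHomeomorph V).injOn⟩
    · exact ⟨∅, isOpen_empty, fun h => (hx h).elim, Set.injOn_empty V⟩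
  choose U hUo hUmem hUinj using hloc
  obtain ⟨t, htA, htc, htU⟩ := TopologicalSpace.countable_cover_nhdsWithin (s := A) (f := U)
    fun x hx => mem_nhdsWithin_of_mem_nhds ((hUo x).mem_nhds (hUmem x hx))
  have := htc.toEncodable
  let W : ℕ → Set E := fun n => ⋃ b ∈ Encodable.decode₂ t n, U (b : E)
  have hWo : ∀ n, MeasurableSet (W n) := fun n =>
    Encodable.iUnion_decode₂_cases (f := fun b : t => U b) (C := fun s => MeasurableSet s)
      MeasurableSet.empty
      fun b => (hUo b).measurableSet
  have hWinj : ∀ n, Set.InjOn V (W n) := fun n =>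
    Encodable.iUnion_decode₂_cases (f := fun b : t => U b) (C := fun s => Set.InjOn V s)
      (Set.injOn_empty V)
      fun b => hUinj b
  have hWA : A ⊆ ⋃ n, W n := by
    rw [Encodable.iUnion_decode₂ (fun b : t => U b)]
    simpa [Set.iUnion_subtype] using htU
  let P : ℕ → Set E := fun n => A ∩ disjointed W n
  have hPm : ∀ n, MeasurableSet (P n) := fun n => hA.inter (MeasurableSet.disjointed hWo n)
  have hPd : Pairwise (Function.onFun Disjoint P) := fun i j hij =>
    (disjoint_disjointed W hij).mono Set.inter_subset_right Set.inter_subset_right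
  have hPU : ⋃ n, P n = A := by
    rw [← Set.inter_iUnion, iUnion_disjointed]
    exact Set.inter_eq_left.2 hWA
  have hPinj : ∀ n, Set.InjOn V (P n) := fun n =>
    (hWinj n).mono (Set.inter_subset_right.trans (disjointed_subset W n))
  have hPder : ∀ n, ∀ x ∈ P n, HasFDerivWithinAt V (V' x) (P n) x := fun n x hx =>
    (hV x hx.1).hasFDerivAt.hasFDerivWithinAt
  have hSm : ∀ n, MeasurableSet (V '' P n) := fun n =>
    measurable_image_of_fderivWithin (hPm n) (hPder n) (hPinj n)
  have htsum : ∀ y, (∑' n, (V '' P n).indicator (1 : E → ℝ≥0∞)) y =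
      (({n | y ∈ V '' P n} : Set ℕ).encard : ℝ≥0∞) := by
    intro y
    rw [tsum_apply (Pi.summable.2 fun _ => ENNReal.summable), ← ENNReal.tsum_set_one,
      tsum_subtype {n | y ∈ V '' P n} (fun _ => (1 : ℝ≥0∞))]
    rfl
  refine ⟨fun y => ({n | y ∈ V '' P n} : Set ℕ).encard, ?_, ?_⟩
  · simp_rw [← htsum]
    simp_rw [tsum_apply (Pi.summable.2 fun _ => ENNReal.summable)]
    exact Measurable.tsum fun n => measurable_one.indicator (hSm n)
  · have hVA : AEMeasurable V (μ.restrict A) :=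
      ContinuousOn.aemeasurable (fun x hx =>
        (hV x hx).hasFDerivAt.continuousAt.continuousWithinAt) hA
    rw [show (fun y => ((({n | y ∈ V '' P n} : Set ℕ).encard : ℕ∞) : ℝ≥0∞)) =
      ∑' n, (V '' P n).indicator (1 : E → ℝ≥0∞) from funext fun y => (htsum y).symm]
    rw [withDensity_tsum fun n => measurable_one.indicator (hSm n)]
    have h1 : μ.restrict A = Measure.sum fun n => μ.restrict (P n) := by
      rw [← hPU, Measure.restrict_iUnion hPd hPm]
    rw [h1, withDensity_sum, Measure.map_sum]
    · congr 1
      ext1 n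
      rw [map_withDensity_abs_det_fderiv_eq_addHaar μ (hPm n).nullMeasurableSet (hPder n)
        (hPinj n), withDensity_indicator_one (hSm n)]
    · rw [← withDensity_sum, ← h1]
      exact hVA.mono_ac (withDensity_absolutelyContinuous _ _)

theorem analyticOnNhd_integral_prod_cos_add_sin {X ι : Type*} [MeasurableSpace X] [Fintype ι]
    {μ : Measure X} [IsFiniteMeasure μ] {α β : ι → X → ℝ} {C : ℝ}
    (hα : ∀ i, AEStronglyMeasurable (α i) μ) (hβ : ∀ i, AEStronglyMeasurable (β i) μ)
    (hα' : ∀ i, ∀ᵐ x ∂μ, |α i x| ≤ C) (hβ' : ∀ i, ∀ᵐ x ∂μ, |β i x| ≤ C) :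
    (∀ s : ℝ, Integrable (fun x => ∏ i, (Real.cos s * α i x + Real.sin s * β i x)) μ) ∧
    AnalyticOnNhd ℝ (fun s : ℝ => ∫ x, ∏ i, (Real.cos s * α i x + Real.sin s * β i x) ∂μ)
      Set.univ := by
  classical
  have hint : ∀ T : Finset ι,
      Integrable (fun x => (∏ i ∈ T, α i x) * ∏ i ∈ Finset.univ \ T, β i x) μ := by
    intro T
    have hb : ∀ᵐ x ∂μ, ∀ i, |α i x| ≤ C ∧ |β i x| ≤ C :=
      ae_all_iff.2 fun i => (hα' i).and (hβ' i)
    refine Integrable.of_bound (C := C ^ T.card * C ^ (Finset.univ \ T).card) ?_ ?_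
    · exact (Finset.aestronglyMeasurable_fun_prod _ fun i _ => hα i).mul
        (Finset.aestronglyMeasurable_fun_prod _ fun i _ => hβ i)
    · filter_upwards [hb] with x hx
      rw [norm_mul, norm_prod, norm_prod]
      refine mul_le_mul ?_ ?_ (Finset.prod_nonneg fun _ _ => norm_nonneg _) ?_
      · exact (Finset.prod_le_prod (fun _ _ => norm_nonneg _) fun i _ => (hx i).1).trans_eq
          (by simp)
      · exact (Finset.prod_le_prod (fun _ _ => norm_nonneg _) fun i _ => (hx i).2).trans_eq
          (by simp)
      · by_cases h : T.card = 0
        · simp [h]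
        · obtain ⟨i, -⟩ := Finset.card_pos.1 (Nat.pos_of_ne_zero h)
          exact pow_nonneg ((abs_nonneg _).trans (hx i).1) _
  have hexp : ∀ (s : ℝ) x, ∏ i, (Real.cos s * α i x + Real.sin s * β i x) =
      ∑ T ∈ (Finset.univ : Finset ι).powerset,
        (Real.cos s ^ T.card * Real.sin s ^ (Finset.univ \ T).card) *
          ((∏ i ∈ T, α i x) * ∏ i ∈ Finset.univ \ T, β i x) := by
    intro s x
    rw [Finset.prod_add]
    refine Finset.sum_congr rfl fun T _ => ?_
    rw [Finset.prod_mul_distrib, Finset.prod_mul_distrib, Finset.prod_const, Finset.prod_const]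
    ring
  simp_rw [hexp]
  refine ⟨fun s => integrable_finsetSum _ fun T _ => (hint T).const_mul _, ?_⟩
  have : (fun s : ℝ => ∫ x, ∑ T ∈ (Finset.univ : Finset ι).powerset,
        (Real.cos s ^ T.card * Real.sin s ^ (Finset.univ \ T).card) *
          ((∏ i ∈ T, α i x) * ∏ i ∈ Finset.univ \ T, β i x) ∂μ) =
      fun s => ∑ T ∈ (Finset.univ : Finset ι).powerset,
        (Real.cos s ^ T.card * Real.sin s ^ (Finset.univ \ T).card) *
          ∫ x, ((∏ i ∈ T, α i x) * ∏ i ∈ Finset.univ \ T, β i x) ∂μ := by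
    ext s
    rw [integral_finsetSum _ fun T _ => (hint T).const_mul _]
    exact Finset.sum_congr rfl fun T _ => integral_const_mul _ _
  rw [this]
  intro s _
  refine Finset.analyticAt_fun_sum _ fun T _ => ?_
  exact ((Real.contDiff_cos.contDiffAt.analyticAt.pow _).mul
    (Real.contDiff_sin.contDiffAt.analyticAt.pow _)).mul analyticAt_const

theorem analyticOnNhd_integral_inner_pow_mul_det {E : Type*} [NormedAddCommGroup E]
    [InnerProductSpace ℝ E] [FiniteDimensional ℝ E] [MeasurableSpace E] [BorelSpace E]
    (μ : Measure E) [IsFiniteMeasure μ]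
    {V : E → E} {V' : E → E →L[ℝ] E} (hVm : Measurable V) (hV'm : Measurable V')
    {C : ℝ} (hx : ∀ᵐ x ∂μ, ‖x‖ ≤ C) (hV : ∀ᵐ x ∂μ, ‖V x‖ ≤ C) (hV' : ∀ᵐ x ∂μ, ‖V' x‖ ≤ C)
    (ξ : E) (k : ℕ) :
    AnalyticOnNhd ℝ (fun s : ℝ => ∫ x, ⟪Real.cos s • x + Real.sin s • V x, ξ⟫ ^ k *
      (Real.cos s • ContinuousLinearMap.id ℝ E + Real.sin s • V' x).det ∂μ) Set.univ := by
  classical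
  let b := stdOrthonormalBasis ℝ E
  let N := Module.finrank ℝ E
  have hdet : ∀ (s : ℝ) x, (Real.cos s • ContinuousLinearMap.id ℝ E + Real.sin s • V' x).det =
      ∑ σ : Equiv.Perm (Fin N), ((Equiv.Perm.sign σ : ℤ) : ℝ) *
        ∏ i, (Real.cos s * ⟪b (σ i), b i⟫ + Real.sin s * ⟪b (σ i), V' x (b i)⟫) := by
    intro s x
    rw [ContinuousLinearMap.det, ← LinearMap.det_toMatrix b.toBasis, Matrix.det_apply']
    refine Finset.sum_congr rfl fun σ _ => ?_
    congr 1
    refine Finset.prod_congr rfl fun i _ => ?_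
    rw [LinearMap.toMatrix_apply]
    simp [b.repr_apply_apply, orthonormal_iff_ite.1 b.orthonormal (σ i) i]
  let α : Equiv.Perm (Fin N) → Fin k ⊕ Fin N → E → ℝ := fun σ =>
    Sum.elim (fun _ x => ⟪x, ξ⟫) (fun i _ => ⟪b (σ i), b i⟫)
  let β : Equiv.Perm (Fin N) → Fin k ⊕ Fin N → E → ℝ := fun σ =>
    Sum.elim (fun _ x => ⟪V x, ξ⟫) (fun i x => ⟪b (σ i), V' x (b i)⟫)
  have hb : ∀ i, ‖b i‖ = 1 := b.orthonormal.1
  let D := max (C * ‖ξ‖) (max 1 C)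
  have key := fun σ => analyticOnNhd_integral_prod_cos_add_sin (μ := μ) (α := α σ) (β := β σ)
    (C := D) ?_ ?_ ?_ ?_
  · have h : (fun s : ℝ => ∫ x, ⟪Real.cos s • x + Real.sin s • V x, ξ⟫ ^ k *
        (Real.cos s • ContinuousLinearMap.id ℝ E + Real.sin s • V' x).det ∂μ) =
        fun s => ∑ σ : Equiv.Perm (Fin N), ((Equiv.Perm.sign σ : ℤ) : ℝ) *
          ∫ x, ∏ i, (Real.cos s * α σ i x + Real.sin s * β σ i x) ∂μ := by
      ext s
      simp_rw [← integral_const_mul]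
      rw [← integral_finsetSum _ fun σ _ => ((key σ).1 s).const_mul _]
      refine integral_congr_ae (Filter.Eventually.of_forall fun x => ?_)
      simp only [hdet, Fintype.prod_sum_type, α, β, Sum.elim_inl, Sum.elim_inr, Finset.prod_const,
        Finset.card_univ, Fintype.card_fin, inner_add_left, inner_smul_left, Finset.mul_sum]
      refine Finset.sum_congr rfl fun σ _ => ?_
      simp only [conj_trivial]
      ring
    rw [h]
    intro s _
    exact Finset.analyticAt_fun_sum _ fun σ _ => analyticAt_const.mul ((key σ).2 s trivial)
  · rintro (i | i)
    · exact (by fun_prop : Measurable fun x : E => ⟪x, ξ⟫).aestronglyMeasurable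
    · exact aestronglyMeasurable_const
  · rintro (i | i)
    · exact (by fun_prop : Measurable fun x : E => ⟪V x, ξ⟫).aestronglyMeasurable
    · exact (by fun_prop : Measurable fun x : E => ⟪b (σ i), V' x (b i)⟫).aestronglyMeasurable
  · rintro (i | i)
    · filter_upwards [hx] with x hx
      refine (abs_real_inner_le_norm _ _).trans (le_max_of_le_left ?_)
      gcongr
    · refine Filter.Eventually.of_forall fun x => (abs_real_inner_le_norm _ _).trans ?_
      simp [hb, D]
  · rintro (i | i)
    · filter_upwards [hV] with x hx
      refine (abs_real_inner_le_norm _ _).trans (le_max_of_le_left ?_)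
      gcongr
    · filter_upwards [hV'] with x hx
      refine (abs_real_inner_le_norm _ _).trans (le_max_of_le_right (le_max_of_le_right ?_))
      rw [hb, one_mul]
      exact ((V' x).le_opNorm _).trans (by rwa [hb, mul_one])

theorem norm_cos_smul_add_sin_smul {E : Type*} [NormedAddCommGroup E]
    [InnerProductSpace ℝ E] {x y : E} (h : ⟪x, y⟫ = 0) (hn : ‖y‖ = ‖x‖) (s : ℝ) :
    ‖Real.cos s • x + Real.sin s • y‖ = ‖x‖ := by
  have h1 : ‖Real.cos s • x + Real.sin s • y‖ ^ 2 = ‖x‖ ^ 2 := by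
    rw [norm_add_sq_real, norm_smul, norm_smul, inner_smul_left, inner_smul_right, h, hn,
      mul_pow, mul_pow, Real.norm_eq_abs, Real.norm_eq_abs, sq_abs, sq_abs]
    linear_combination ‖x‖ ^ 2 * Real.cos_sq_add_sin_sq s
  exact (sq_eq_sq₀ (norm_nonneg _) (norm_nonneg _)).1 h1

theorem bijective_cos_smul_add_sin_smul {E : Type*} [NormedAddCommGroup E]
    [NormedSpace ℝ E] [CompleteSpace E] {V : E → E} {K : NNReal} (hK : LipschitzWith K V) {s : ℝ}
    (hs : |Real.sin s| * K < Real.cos s) :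
    Function.Bijective fun x => Real.cos s • x + Real.sin s • V x := by
  have hc : 0 < Real.cos s := lt_of_le_of_lt (by positivity) hs
  have h : ApproximatesLinearOn (fun x => Real.cos s • x + Real.sin s • V x)
      ((ContinuousLinearEquiv.smulLeft (Units.mk0 (Real.cos s) hc.ne') : E ≃L[ℝ] E) : E →L[ℝ] E)
      Set.univ (Real.nnabs (Real.sin s) * K) := by
    intro x _ y _
    have : Real.cos s • x + Real.sin s • V x - (Real.cos s • y + Real.sin s • V y) -
        Real.cos s • (x - y) = Real.sin s • (V x - V y) := by module
    change ‖Real.cos s • x + Real.sin s • V x - (Real.cos s • y + Real.sin s • V y) -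
        Real.cos s • (x - y)‖ ≤ _
    rw [this, norm_smul]
    push_cast
    rw [mul_assoc, Real.norm_eq_abs]
    gcongr
    exact hK.norm_sub_le x y
  have hcond : Subsingleton E ∨ Real.nnabs (Real.sin s) * K <
      ‖((ContinuousLinearEquiv.smulLeft (Units.mk0 (Real.cos s) hc.ne') : E ≃L[ℝ] E).symm :
        E →L[ℝ] E)‖₊⁻¹ := by
    rcases subsingleton_or_nontrivial E with h | h
    · exact Or.inl h
    · right
      have h2 : ((ContinuousLinearEquiv.smulLeft (Units.mk0 (Real.cos s) hc.ne') :
          E ≃L[ℝ] E).symm : E →L[ℝ] E) = (Real.cos s)⁻¹ • ContinuousLinearMap.id ℝ E := by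
        ext x; rfl
      rw [h2, ← NNReal.coe_lt_coe]
      push_cast
      rw [norm_smul, ContinuousLinearMap.norm_id, mul_one, norm_inv, inv_inv, Real.norm_eq_abs,
        abs_of_pos hc]
      exact hs
  exact ⟨Set.injOn_univ.1 (h.injOn hcond), h.surjective hcond⟩

theorem integral_inner_pow_mul_det_fderiv_eq {E : Type*} [NormedAddCommGroup E]
    [InnerProductSpace ℝ E] [FiniteDimensional ℝ E] [MeasurableSpace E] [BorelSpace E]
    (μ : Measure E) [μ.IsAddHaarMeasure]
    {V : E → E} {K : NNReal} (hK : LipschitzWith K V)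
    (hV : ∀ x ≠ 0, DifferentiableAt ℝ V x) (hn : ∀ x, ‖V x‖ = ‖x‖) (ho : ∀ x, ⟪x, V x⟫ = 0)
    (ξ : E) (k : ℕ) :
    ∫ x in ball (0 : E) 1 \ {0}, ⟪V x, ξ⟫ ^ k * (fderiv ℝ V x).det ∂μ =
      ∫ x in ball (0 : E) 1 \ {0}, ⟪x, ξ⟫ ^ k ∂μ := by
  set Ω : Set E := ball (0 : E) 1 \ {0} with hΩ
  have hΩm : MeasurableSet Ω := measurableSet_ball.diff (measurableSet_singleton 0)
  have hfin : IsFiniteMeasure (μ.restrict Ω) :=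
    ⟨by
      rw [Measure.restrict_apply_univ]
      exact (measure_mono Set.sdiff_subset).trans_lt measure_ball_lt_top⟩
  have hΩb : ∀ᵐ x ∂μ.restrict Ω, ‖x‖ ≤ 1 := by
    filter_upwards [ae_restrict_mem hΩm] with x hx
    exact (mem_ball_zero_iff.1 hx.1).le
  have han := analyticOnNhd_integral_inner_pow_mul_det (μ.restrict Ω) (V := V) (V' := fderiv ℝ V)
    hK.continuous.measurable (measurable_fderiv ℝ V) (C := max 1 K)
    (hΩb.mono fun x hx => le_max_of_le_left hx)
    (hΩb.mono fun x hx => le_max_of_le_left ((hn x).trans_le hx))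
    (Filter.Eventually.of_forall fun x => le_max_of_le_right (norm_fderiv_le_of_lipschitz ℝ hK))
    ξ k
  have hloc : (fun s : ℝ => ∫ x in Ω, ⟪Real.cos s • x + Real.sin s • V x, ξ⟫ ^ k *
      (Real.cos s • ContinuousLinearMap.id ℝ E + Real.sin s • fderiv ℝ V x).det ∂μ) =ᶠ[nhds 0]
      fun _ => ∫ x in Ω, ⟪x, ξ⟫ ^ k ∂μ := by
    have hdc : ContinuousAt (fun A : E →L[ℝ] E => A.det) (ContinuousLinearMap.id ℝ E) :=
      ContinuousLinearMap.continuous_det.continuousAt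
    have hd1 : (0 : ℝ) < (ContinuousLinearMap.id ℝ E).det := by
      simp [ContinuousLinearMap.det]
    obtain ⟨ε, hε, hdet⟩ := Metric.eventually_nhds_iff.1 (hdc.eventually (lt_mem_nhds hd1))
    have e1 : ∀ᶠ s in nhds (0 : ℝ), |Real.sin s| * K < Real.cos s := by
      refine ContinuousAt.eventually_lt (by fun_prop) (by fun_prop) ?_
      simp
    have e2 : ∀ᶠ s in nhds (0 : ℝ), |Real.cos s - 1| + |Real.sin s| * K < ε := by
      refine ContinuousAt.eventually_lt (by fun_prop) (by fun_prop) ?_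
      simpa
    filter_upwards [e1, e2] with s h1 h2
    have hbij := bijective_cos_smul_add_sin_smul hK h1
    set F : E → E := fun x => Real.cos s • x + Real.sin s • V x with hF
    have hFn : ∀ x, ‖F x‖ = ‖x‖ := fun x => norm_cos_smul_add_sin_smul (ho x) (hn x) s
    have himg : F '' Ω = Ω := by
      ext y
      have hiff : ∀ x, F x ∈ Ω ↔ x ∈ Ω := fun x => by
        simp only [hΩ, Set.mem_sdiff, mem_ball_zero_iff, Set.mem_singleton_iff, hFn,
          ← norm_eq_zero (a := F x), ← norm_eq_zero (a := x)]
      constructor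
      · rintro ⟨x, hx, rfl⟩
        exact (hiff x).2 hx
      · intro hy
        obtain ⟨x, rfl⟩ := hbij.2 y
        exact ⟨x, (hiff x).1 hy, rfl⟩
    have hder : ∀ x ∈ Ω, HasFDerivWithinAt F
        (Real.cos s • ContinuousLinearMap.id ℝ E + Real.sin s • fderiv ℝ V x) Ω x := fun x hx =>
      (((hasFDerivAt_id x).const_smul _).add
        ((hV x hx.2).hasFDerivAt.const_smul _)).hasFDerivWithinAt
    have hcv := integral_image_eq_integral_abs_det_fderiv_smul μ hΩm hder (hbij.1.injOn)
      (fun y => ⟪y, ξ⟫ ^ k)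
    rw [himg] at hcv
    rw [hcv]
    refine setIntegral_congr_fun hΩm fun x hx => ?_
    have hpos : 0 < (Real.cos s • ContinuousLinearMap.id ℝ E + Real.sin s • fderiv ℝ V x).det := by
      refine hdet ?_
      rw [dist_eq_norm]
      have : Real.cos s • ContinuousLinearMap.id ℝ E + Real.sin s • fderiv ℝ V x -
          ContinuousLinearMap.id ℝ E = (Real.cos s - 1) • ContinuousLinearMap.id ℝ E +
            Real.sin s • fderiv ℝ V x := by module
      rw [this]
      refine (norm_add_le _ _).trans_lt (lt_of_le_of_lt ?_ h2)
      rw [norm_smul, norm_smul, Real.norm_eq_abs, Real.norm_eq_abs]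
      gcongr
      · exact mul_le_of_le_one_right (abs_nonneg _) ContinuousLinearMap.norm_id_le
      · exact norm_fderiv_le_of_lipschitz ℝ hK
    simp only [abs_of_pos hpos, smul_eq_mul, hF]
    ring
  have := han.eqOn_of_preconnected_of_eventuallyEq (analyticOnNhd_const) isPreconnected_univ
    (Set.mem_univ 0) hloc (Set.mem_univ (Real.pi / 2))
  simpa using this

theorem fderiv_neg_of_even {E F : Type*} [NormedAddCommGroup E] [NormedSpace ℝ E]
    [NormedAddCommGroup F] [NormedSpace ℝ F] {V : E → F} (he : ∀ x, V (-x) = V x) (x : E) :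
    fderiv ℝ V (-x) = -fderiv ℝ V x := by
  have h := (ContinuousLinearEquiv.neg ℝ (M := E)).comp_right_fderiv (f := V) (x := x)
  have hc : V ∘ (ContinuousLinearEquiv.neg ℝ (M := E)) = V := funext fun y => he y
  rw [hc] at h
  rw [h]
  ext y
  simp

theorem not_exists_even_tangent_field_of_contDiffAt {E : Type*} [NormedAddCommGroup E]
    [InnerProductSpace ℝ E] [FiniteDimensional ℝ E] [Nontrivial E]
    {V : E → E} {K : NNReal} (hK : LipschitzWith K V)
    (hV : ∀ x ≠ 0, ContDiffAt ℝ 1 V x) (hn : ∀ x, ‖V x‖ = ‖x‖) (ho : ∀ x, ⟪x, V x⟫ = 0)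
    (he : ∀ x, V (-x) = V x) : False := by
  borelize E
  let μ : Measure E := volume
  set Ω : Set E := ball (0 : E) 1 \ {0} with hΩ
  have hΩm : MeasurableSet Ω := measurableSet_ball.diff (measurableSet_singleton 0)
  let J : E → ℝ := fun x => (fderiv ℝ V x).det
  have hJm : Measurable J :=
    ContinuousLinearMap.continuous_det.measurable.comp (measurable_fderiv ℝ V)
  have hVm : Measurable V := hK.continuous.measurable
  have hfd : ∀ x, fderiv ℝ V (-x) = -fderiv ℝ V x := fderiv_neg_of_even he
  have hJneg : ∀ x, J (-x) = (-1) ^ Module.finrank ℝ E * J x := by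
    intro x
    have : fderiv ℝ V (-x) = (-1 : ℝ) • fderiv ℝ V x := by rw [hfd, neg_one_smul]
    simp only [J, this, ContinuousLinearMap.det, ContinuousLinearMap.toLinearMap_smul,
      LinearMap.det_smul]
  have hJnegabs : ∀ x, |J (-x)| = |J x| := by
    intro x
    rw [hJneg, abs_mul, abs_pow, abs_neg, abs_one, one_pow, one_mul]
  obtain ⟨C, hC⟩ : ∃ C, ∀ x, |J x| ≤ C := by
    obtain ⟨C, hC⟩ := (isCompact_closedBall (0 : E →L[ℝ] E) K).exists_bound_of_continuousOn
      ContinuousLinearMap.continuous_det.continuousOn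
    exact ⟨C, fun x => hC _ (mem_closedBall_zero_iff.2 (norm_fderiv_le_of_lipschitz ℝ hK))⟩
  let w : E → ℝ≥0∞ := fun x => ENNReal.ofReal |J x|
  have hwm : Measurable w := hJm.abs.ennreal_ofReal
  let D : Set E → Measure E := fun S => Measure.map V ((μ.restrict S).withDensity w)
  have hDfin : ∀ S ⊆ Ω, IsFiniteMeasure (D S) := by
    intro S hS
    have : IsFiniteMeasure ((μ.restrict S).withDensity w) := by
      refine isFiniteMeasure_withDensity (ne_of_lt ?_)
      calc ∫⁻ x in S, w x ∂μ ≤ ∫⁻ x in S, ENNReal.ofReal C ∂μ :=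
            lintegral_mono fun x => ENNReal.ofReal_le_ofReal (hC x)
        _ = ENNReal.ofReal C * μ S := setLIntegral_const _ _
        _ < ∞ := ENNReal.mul_lt_top ENNReal.ofReal_lt_top
            ((measure_mono (hS.trans Set.sdiff_subset)).trans_lt measure_ball_lt_top)
    exact Measure.isFiniteMeasure_map _ _
  have hDneg : ∀ S, MeasurableSet S → D (-S) = D S := by
    intro S hS
    have hmp : MeasurePreserving (Neg.neg : E → E) (μ.restrict (-S)) (μ.restrict S) := by
      have := (Measure.measurePreserving_neg μ).restrict_preimage hS
      simpa using this
    ext T hT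
    simp only [D]
    rw [Measure.map_apply hVm hT, Measure.map_apply hVm hT, withDensity_apply _ (hVm hT),
      withDensity_apply _ (hVm hT), ← lintegral_indicator (hVm hT), ← lintegral_indicator (hVm hT),
      ← hmp.lintegral_comp (hwm.indicator (hVm hT))]
    refine lintegral_congr fun x => ?_
    have hx : -x ∈ V ⁻¹' T ↔ x ∈ V ⁻¹' T := by rw [Set.mem_preimage, he, Set.mem_preimage]
    by_cases h : x ∈ V ⁻¹' T
    · rw [Set.indicator_of_mem h, Set.indicator_of_mem (hx.2 h)]
      simp only [w, hJnegabs]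
    · rw [Set.indicator_of_notMem h, Set.indicator_of_notMem (mt hx.1 h)]
  have hDunion : ∀ S T, MeasurableSet T → Disjoint S T → D (S ∪ T) = D S + D T := by
    intro S T hT hST
    simp only [D]
    rw [Measure.restrict_union hST hT, withDensity_add_measure, Measure.map_add _ _ hVm]
  have hDnull : ∀ S T, S =ᵐ[μ] T → D S = D T := by
    intro S T h
    simp only [D]
    rw [Measure.restrict_congr_set h]
  -- the signed change of variables formula
  let Ap : Set E := Ω ∩ {x | 0 < J x}
  let Am : Set E := Ω ∩ {x | J x < 0}
  have hAp : MeasurableSet Ap := hΩm.inter (measurableSet_lt measurable_const hJm)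
  have hAm : MeasurableSet Am := hΩm.inter (measurableSet_lt hJm measurable_const)
  have hΩfin : IsFiniteMeasure (μ.restrict Ω) :=
    ⟨by
      rw [Measure.restrict_apply_univ]
      exact (measure_mono Set.sdiff_subset).trans_lt measure_ball_lt_top⟩
  have hΩb : ∀ S ⊆ Ω, MeasurableSet S → ∀ᵐ x ∂μ.restrict S, ‖x‖ ≤ 1 := by
    intro S hS hSm
    filter_upwards [ae_restrict_mem hSm] with x hx
    exact (mem_ball_zero_iff.1 (hS hx).1).le
  have hDb : ∀ S ⊆ Ω, MeasurableSet S → ∀ᵐ x ∂D S, ‖x‖ ≤ 1 := by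
    intro S hS hSm
    refine (ae_map_iff hVm.aemeasurable (measurableSet_le measurable_norm measurable_const)).2 ?_
    have := withDensity_absolutelyContinuous (μ.restrict S) w
    filter_upwards [this (hΩb S hS hSm)] with x hx
    rwa [hn]
  have hDint : ∀ S, ∀ (ξ : E) (k : ℕ), ∫ y, ⟪y, ξ⟫ ^ k ∂(D S) =
      ∫ x in S, |J x| * ⟪V x, ξ⟫ ^ k ∂μ := by
    intro S ξ k
    simp only [D]
    rw [integral_map hVm.aemeasurable (by fun_prop : Continuous _).aestronglyMeasurable,
      integral_withDensity_eq_integral_toReal_smul hwm (by simp [w])]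
    simp [w, ENNReal.toReal_ofReal]
  have hbdint : ∀ S ⊆ Ω, MeasurableSet S → ∀ ξ k,
      IntegrableOn (fun x => J x * ⟪V x, ξ⟫ ^ k) S μ := by
    intro S hS hSm ξ k
    have : IsFiniteMeasure (μ.restrict S) :=
      isFiniteMeasure_of_le _ (Measure.restrict_mono hS le_rfl)
    refine Integrable.of_bound (C := C * ‖ξ‖ ^ k) (by fun_prop) ?_
    filter_upwards [hΩb S hS hSm] with x hx
    rw [norm_mul, norm_pow]
    gcongr
    · exact (abs_nonneg _).trans (hC x)
    · exact hC x
    · exact (abs_real_inner_le_norm _ _).trans (mul_le_of_le_one_left (norm_nonneg _) (by rwa [hn]))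
  have hkey : D Ap = D Am + μ.restrict Ω := by
    have := hDfin Ap Set.inter_subset_left
    have := hDfin Am Set.inter_subset_left
    refine measure_ext_of_inner_pow_moments 1 (hDb Ap Set.inter_subset_left hAp) ?_ ?_
    · rw [ae_add_measure_iff]
      exact ⟨hDb Am Set.inter_subset_left hAm, hΩb Ω le_rfl hΩm⟩
    · intro ξ k
      have hb : ∀ (ρ : Measure E) [IsFiniteMeasure ρ], (∀ᵐ x ∂ρ, ‖x‖ ≤ 1) →
          Integrable (fun y : E => ⟪y, ξ⟫ ^ k) ρ := by
        intro ρ _ hρ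
        refine Integrable.of_bound (C := ‖ξ‖ ^ k) (by fun_prop) ?_
        filter_upwards [hρ] with x hx
        rw [norm_pow]
        gcongr
        exact (abs_real_inner_le_norm _ _).trans (mul_le_of_le_one_left (norm_nonneg _) hx)
      rw [integral_add_measure (hb _ (hDb Am Set.inter_subset_left hAm)) (hb _ (hΩb Ω le_rfl hΩm)),
        hDint, hDint, ← integral_inner_pow_mul_det_fderiv_eq μ hK
          (fun x hx => (hV x hx).differentiableAt one_ne_zero) hn ho ξ k]
      have hsplit : ∫ x in Ω, ⟪V x, ξ⟫ ^ k * (fderiv ℝ V x).det ∂μ =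
          (∫ x in Ap, J x * ⟪V x, ξ⟫ ^ k ∂μ) + ∫ x in Am, J x * ⟪V x, ξ⟫ ^ k ∂μ := by
        rw [← setIntegral_union _ hAm (hbdint Ap Set.inter_subset_left hAp ξ k)
          (hbdint Am Set.inter_subset_left hAm ξ k)]
        · have : Ap ∪ Am ⊆ Ω := Set.union_subset Set.inter_subset_left Set.inter_subset_left
          rw [← setIntegral_eq_of_subset_of_forall_sdiff_eq_zero hΩm this]
          · exact integral_congr_ae (Filter.Eventually.of_forall fun x => mul_comm _ _)
          · rintro x ⟨hx, hx'⟩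
            have : J x = 0 := by
              by_contra h
              rcases lt_or_gt_of_ne h with h | h
              · exact hx' (Or.inr ⟨hx, h⟩)
              · exact hx' (Or.inl ⟨hx, h⟩)
            rw [this, zero_mul]
        · exact Set.disjoint_left.2 fun x h1 h2 =>
            lt_asymm (show 0 < J x from h1.2) (show J x < 0 from h2.2)
      have h1 : ∫ x in Ap, |J x| * ⟪V x, ξ⟫ ^ k ∂μ = ∫ x in Ap, J x * ⟪V x, ξ⟫ ^ k ∂μ :=
        setIntegral_congr_fun hAp fun x hx => by simp only [abs_of_pos (show 0 < J x from hx.2)]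
      have h2 : ∫ x in Am, |J x| * ⟪V x, ξ⟫ ^ k ∂μ = -∫ x in Am, J x * ⟪V x, ξ⟫ ^ k ∂μ := by
        rw [← integral_neg]
        exact setIntegral_congr_fun hAm fun x hx => by
          simp only [abs_of_neg (show J x < 0 from hx.2), neg_mul]
      rw [h1, h2, hsplit]
      ring
  -- split into two half balls exchanged by the antipodal map
  obtain ⟨e, he0⟩ := exists_ne (0 : E)
  let H : Set E := {x | 0 < ⟪x, e⟫}
  have hH : MeasurableSet H := measurableSet_lt measurable_const (by fun_prop)
  have hnull : μ {x : E | ⟪x, e⟫ = 0} = 0 := by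
    have : {x : E | ⟪x, e⟫ = 0} = ((innerₛₗ ℝ e).ker : Set E) := by
      ext x
      simp [real_inner_comm]
    rw [this]
    refine Measure.addHaar_submodule μ _ fun h => he0 ?_
    have : e ∈ (innerₛₗ ℝ e).ker := h ▸ Submodule.mem_top
    simpa using this
  have hsplitH : ∀ S, MeasurableSet S → D S = D (S ∩ H) + D (S ∩ -H) := by
    intro S hS
    rw [← hDunion _ _ (hS.inter hH.neg), ← Set.inter_union_distrib_left]
    · refine hDnull _ _ (Filter.EventuallyEq.symm ?_)
      have : ∀ᵐ x ∂μ, ⟪x, e⟫ ≠ 0 := measure_eq_zero_iff_ae_notMem.1 hnull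
      filter_upwards [this] with x hx
      refine propext ⟨fun h => h.1, fun h => ⟨h, ?_⟩⟩
      rcases lt_or_gt_of_ne hx with h' | h'
      · exact Or.inr (by simpa [H, inner_neg_left] using h')
      · exact Or.inl h'
    · refine Set.disjoint_left.2 fun x h1 h2 => ?_
      have h3 : 0 < ⟪x, e⟫ := h1.2
      have h4 : 0 < ⟪-x, e⟫ := h2.2
      rw [inner_neg_left] at h4
      linarith
  let P := Ap ∩ H
  let M := Am ∩ H
  have hP : MeasurableSet P := hAp.inter hH
  have hM : MeasurableSet M := hAm.inter hH
  have hΩneg : ∀ x, -x ∈ Ω ↔ x ∈ Ω := fun x => by simp [hΩ]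
  have hcase : (Ap ∩ -H = -P ∧ Am ∩ -H = -M) ∨ (Ap ∩ -H = -M ∧ Am ∩ -H = -P) := by
    rcases Nat.even_or_odd (Module.finrank ℝ E) with hN | hN
    · left
      constructor <;> ext x <;>
        simp [P, M, Ap, Am, hΩneg, hJneg, hN.neg_one_pow]
    · right
      constructor <;> ext x <;>
        simp [P, M, Ap, Am, hΩneg, hJneg, hN.neg_one_pow]
  have hstrict : ∀ x ∈ Ω, HasStrictFDerivAt V (fderiv ℝ V x) x := fun x hx =>
    (hV x hx.2).hasStrictFDerivAt one_ne_zero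
  obtain ⟨p, hpm, hp⟩ := exists_map_withDensity_abs_det_eq_withDensity_enat μ hP
    (fun x hx => hstrict x hx.1.1) (fun x hx => hx.1.2.ne')
  obtain ⟨m, hmm, hm⟩ := exists_map_withDensity_abs_det_eq_withDensity_enat μ hM
    (fun x hx => hstrict x hx.1.1) (fun x hx => hx.1.2.ne)
  have hDP : D P = μ.withDensity fun y => (p y : ℝ≥0∞) := hp
  have hDM : D M = μ.withDensity fun y => (m y : ℝ≥0∞) := hm
  have hfp := hDfin P (Set.inter_subset_left.trans Set.inter_subset_left)
  have hfm := hDfin M (Set.inter_subset_left.trans Set.inter_subset_left)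
  have hpfin : ∀ᵐ y ∂μ, (p y : ℝ≥0∞) < ∞ := by
    refine ae_lt_top hpm ?_
    have := measure_ne_top (D P) Set.univ
    rwa [hDP, withDensity_apply _ MeasurableSet.univ, Measure.restrict_univ] at this
  have hmfin : ∀ᵐ y ∂μ, (m y : ℝ≥0∞) < ∞ := by
    refine ae_lt_top hmm ?_
    have := measure_ne_top (D M) Set.univ
    rwa [hDM, withDensity_apply _ MeasurableSet.univ, Measure.restrict_univ] at this
  have hΩpos : μ Ω ≠ 0 := by
    rw [hΩ, measure_sdiff_null (measure_singleton 0)]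
    exact (measure_ball_pos μ 0 one_pos).ne'
  have hΩd : μ.restrict Ω = μ.withDensity (Ω.indicator 1) := (withDensity_indicator_one hΩm).symm
  have hfinal : ∃ y, y ∈ Ω ∧ (p y : ℝ≥0∞) < ∞ ∧ (m y : ℝ≥0∞) < ∞ ∧
      ((p y + p y : ℝ≥0∞) = m y + m y + 1 ∨ (p y + m y : ℝ≥0∞) = m y + p y + 1) := by
    have hae : ∀ᵐ y ∂μ, y ∈ Ω → ((p y + p y : ℝ≥0∞) = m y + m y + 1 ∨
        (p y + m y : ℝ≥0∞) = m y + p y + 1) := by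
      have hi1 : Measurable (Ω.indicator (1 : E → ℝ≥0∞)) := measurable_one.indicator hΩm
      rw [hsplitH Ap hAp, hsplitH Am hAm] at hkey
      rcases hcase with ⟨h1, h2⟩ | ⟨h1, h2⟩
      · rw [h1, h2, hDneg _ hP, hDneg _ hM] at hkey
        change D P + D P = D M + D M + _ at hkey
        rw [hDP, hDM, hΩd, ← withDensity_add_left hpm, ← withDensity_add_left hmm,
          ← withDensity_add_left (hmm.add hmm),
          withDensity_eq_iff_of_sigmaFinite (by fun_prop) (by fun_prop)] at hkey
        filter_upwards [hkey] with y hy hyΩ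
        left
        simpa [hyΩ] using hy
      · rw [h1, h2, hDneg _ hP, hDneg _ hM] at hkey
        change D P + D M = D M + D P + _ at hkey
        rw [hDP, hDM, hΩd, ← withDensity_add_left hpm, ← withDensity_add_left hmm,
          ← withDensity_add_left (hmm.add hpm),
          withDensity_eq_iff_of_sigmaFinite (by fun_prop) (by fun_prop)] at hkey
        filter_upwards [hkey] with y hy hyΩ
        right
        simpa [hyΩ] using hy
    by_contra hcon
    push Not at hcon
    refine hΩpos (measure_eq_zero_iff_ae_notMem.2 ?_)
    filter_upwards [hae, hpfin, hmfin] with y h1 h2 h3 h4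
    rcases h1 h4 with h | h
    · exact (hcon y h4 h2 h3).1 h
    · exact (hcon y h4 h2 h3).2 h
  obtain ⟨y, -, h1, h2, h3⟩ := hfinal
  have h1' : p y ≠ ⊤ := fun h => by simp [h] at h1
  have h2' : m y ≠ ⊤ := fun h => by simp [h] at h2
  obtain ⟨a, ha⟩ := ENat.ne_top_iff_exists.1 h1'
  obtain ⟨b, hb⟩ := ENat.ne_top_iff_exists.1 h2'
  rw [← ha, ← hb] at h3
  simp only [ENat.toENNReal_coe] at h3
  norm_cast at h3
  omega

theorem norm_inv_norm_smul_sub_le {E : Type*} [NormedAddCommGroup E] [NormedSpace ℝ E] {x : E}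
    (hx : x ≠ 0) (y : E) : ‖x‖ * ‖‖x‖⁻¹ • x - ‖y‖⁻¹ • y‖ ≤ 2 * ‖x - y‖ := by
  rcases eq_or_ne y 0 with rfl | hy
  · simp only [smul_zero, sub_zero]
    rw [norm_smul, norm_inv, norm_norm, inv_mul_cancel₀ (norm_ne_zero_iff.2 hx)]
    linarith [norm_nonneg x]
  have hx' := norm_ne_zero_iff.2 hx
  have hy' := norm_ne_zero_iff.2 hy
  calc ‖x‖ * ‖‖x‖⁻¹ • x - ‖y‖⁻¹ • y‖ = ‖‖x‖ • (‖x‖⁻¹ • x - ‖y‖⁻¹ • y)‖ := by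
        rw [norm_smul, norm_norm]
    _ = ‖(x - y) + (‖y‖ - ‖x‖) • ‖y‖⁻¹ • y‖ := by
        rw [smul_sub, sub_smul, smul_inv_smul₀ hx', smul_inv_smul₀ hy']
        congr 1
        abel
    _ ≤ ‖x - y‖ + ‖(‖y‖ - ‖x‖) • ‖y‖⁻¹ • y‖ := norm_add_le _ _
    _ ≤ ‖x - y‖ + ‖x - y‖ := by
        gcongr
        rw [norm_smul, norm_smul, norm_inv, norm_norm, inv_mul_cancel₀ hy', mul_one,
          Real.norm_eq_abs, norm_sub_rev]
        exact abs_norm_sub_norm_le _ _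
    _ = 2 * ‖x - y‖ := by ring

theorem exists_contDiff_norm_sub_lt_of_continuousOn {E F : Type*} [NormedAddCommGroup E]
    [NormedSpace ℝ E] [FiniteDimensional ℝ E] [NormedAddCommGroup F] [NormedSpace ℝ F]
    {S : Set E} (hS : IsClosed S) {s : E → F} (hs : ContinuousOn s S) {ε : ℝ} (hε : 0 < ε) :
    ∃ p : E → F, ContDiff ℝ 1 p ∧ ∀ x ∈ S, ‖p x - s x‖ < ε := by
  obtain ⟨p, hp⟩ := exists_contMDiffMap_forall_mem_convex_of_local_const (modelWithCornersSelf ℝ E)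
    (n := 1) (t := fun x => {y : F | x ∈ S → ‖y - s x‖ < ε}) (by
      intro x
      by_cases hx : x ∈ S
      · have : {y : F | x ∈ S → ‖y - s x‖ < ε} = ball (s x) ε := by
          ext y; simp [hx, dist_eq_norm]
        rw [this]
        exact convex_ball _ _
      · have : {y : F | x ∈ S → ‖y - s x‖ < ε} = Set.univ := by
          ext y; simp [hx]
        rw [this]
        exact convex_univ) (by
      intro x
      by_cases hx : x ∈ S
      · refine ⟨s x, ?_⟩
        have := (Metric.continuousOn_iff'.1 hs) x hx ε hε
        filter_upwards [mem_nhdsWithin_iff_eventually.1 this] with y hy hyS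
        rw [← dist_eq_norm, dist_comm]
        exact hy hyS
      · refine ⟨0, ?_⟩
        filter_upwards [hS.isOpen_compl.mem_nhds hx] with y hy hyS
        exact absurd hyS hy)
  exact ⟨p, p.contMDiff.contDiff, fun x hx => hp x hx⟩

theorem not_exists_even_tangent_field_of_contDiff {E : Type*} [NormedAddCommGroup E]
    [InnerProductSpace ℝ E] [FiniteDimensional ℝ E] [Nontrivial E] {w : E → E}
    (hw : ContDiff ℝ 1 w) (hne : ∀ u, ‖u‖ = 1 → w u ≠ 0) (ho : ∀ u, ‖u‖ = 1 → ⟪u, w u⟫ = 0)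
    (he : ∀ u, w (-u) = w u) : False := by
  let V : E → E := fun x => ‖x‖ • ‖w (‖x‖⁻¹ • x)‖⁻¹ • w (‖x‖⁻¹ • x)
  have hunit : ∀ x : E, x ≠ 0 → ‖‖x‖⁻¹ • x‖ = 1 := fun x hx => norm_smul_inv_norm (𝕜 := ℝ) hx
  have hnorm : ∀ x, ‖V x‖ = ‖x‖ := by
    intro x
    rcases eq_or_ne x 0 with rfl | hx
    · simp [V]
    · simp only [V]
      rw [norm_smul, norm_norm, norm_smul, norm_inv, norm_norm,
        inv_mul_cancel₀ (norm_ne_zero_iff.2 (hne _ (hunit x hx))), mul_one]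
  have hdiff : ∀ x ≠ 0, ContDiffAt ℝ 1 V x := by
    intro x hx
    have hn : ContDiffAt ℝ 1 (fun x : E => ‖x‖) x := contDiffAt_norm ℝ hx
    have h1 : ContDiffAt ℝ 1 (fun x : E => w (‖x‖⁻¹ • x)) x :=
      hw.contDiffAt.comp x ((hn.inv (norm_ne_zero_iff.2 hx)).smul contDiffAt_id)
    have h2 := hne _ (hunit x hx)
    exact hn.smul (((h1.norm ℝ h2).inv (norm_ne_zero_iff.2 h2)).smul h1)
  have hloc : LocallyLipschitzOn (sphere (0 : E) 1) V := by
    intro x hx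
    obtain ⟨L, t, ht, hL⟩ := (hdiff x (ne_zero_of_mem_unit_sphere ⟨x, hx⟩)).exists_lipschitzOnWith
    exact ⟨L, t, mem_nhdsWithin_of_mem_nhds ht, hL⟩
  obtain ⟨L, hL⟩ := hloc.exists_lipschitzOnWith_of_compact (isCompact_sphere 0 1)
  have hhom : ∀ x, V x = ‖x‖ • V (‖x‖⁻¹ • x) := by
    intro x
    rcases eq_or_ne x 0 with rfl | hx
    · simp [V]
    · simp only [V]
      rw [hunit x hx, inv_one, one_smul, one_smul]
  have hLip : LipschitzWith (2 * L + 1) V := by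
    refine LipschitzWith.of_dist_le_mul fun x y => ?_
    rw [dist_eq_norm, dist_eq_norm]
    push_cast
    rcases eq_or_ne x 0 with rfl | hx
    · have : V 0 = 0 := norm_eq_zero.1 (by rw [hnorm, norm_zero])
      rw [this, zero_sub, norm_neg, hnorm, zero_sub, norm_neg]
      exact le_mul_of_one_le_left (norm_nonneg _) (by linarith [L.2])
    rcases eq_or_ne y 0 with rfl | hy
    · have : V 0 = 0 := norm_eq_zero.1 (by rw [hnorm, norm_zero])
      rw [this, sub_zero, hnorm, sub_zero]
      exact le_mul_of_one_le_left (norm_nonneg _) (by linarith [L.2])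
    have h1 : ‖V (‖x‖⁻¹ • x) - V (‖y‖⁻¹ • y)‖ ≤ L * ‖‖x‖⁻¹ • x - ‖y‖⁻¹ • y‖ := by
      rw [← dist_eq_norm, ← dist_eq_norm]
      exact hL.dist_le_mul _ (mem_sphere_zero_iff_norm.2 (hunit x hx)) _
        (mem_sphere_zero_iff_norm.2 (hunit y hy))
    have h2 := norm_inv_norm_smul_sub_le hx y
    calc ‖V x - V y‖ = ‖‖x‖ • (V (‖x‖⁻¹ • x) - V (‖y‖⁻¹ • y)) +
          (‖x‖ - ‖y‖) • V (‖y‖⁻¹ • y)‖ := by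
          rw [hhom x, hhom y, smul_sub, sub_smul]
          congr 1
          abel
      _ ≤ ‖x‖ * (L * ‖‖x‖⁻¹ • x - ‖y‖⁻¹ • y‖) + ‖x - y‖ := by
          refine (norm_add_le _ _).trans (add_le_add ?_ ?_)
          · rw [norm_smul, norm_norm]
            gcongr
          · rw [norm_smul, hnorm, hunit y hy, mul_one]
            exact abs_norm_sub_norm_le _ _
      _ = L * (‖x‖ * ‖‖x‖⁻¹ • x - ‖y‖⁻¹ • y‖) + ‖x - y‖ := by ring
      _ ≤ L * (2 * ‖x - y‖) + ‖x - y‖ := by gcongr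
      _ = (2 * L + 1) * ‖x - y‖ := by ring
  refine not_exists_even_tangent_field_of_contDiffAt hLip hdiff hnorm ?_ ?_
  · intro x
    rcases eq_or_ne x 0 with rfl | hx
    · simp
    · have := ho _ (hunit x hx)
      rw [inner_smul_left] at this
      have h3 : ⟪x, w (‖x‖⁻¹ • x)⟫ = 0 := by
        refine (mul_eq_zero.1 this).resolve_left ?_
        simpa using hx
      simp only [V, inner_smul_right, h3, mul_zero]
  · intro x
    simp only [V, norm_neg, smul_neg, he]

theorem not_exists_even_tangent_field {E : Type*} [NormedAddCommGroup E]
    [InnerProductSpace ℝ E] [FiniteDimensional ℝ E] [Nontrivial E] {s : E → E}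
    (hs : ContinuousOn s (sphere 0 1)) (hne : ∀ u, ‖u‖ = 1 → s u ≠ 0)
    (ho : ∀ u, ‖u‖ = 1 → ⟪u, s u⟫ = 0) (he : ∀ u, ‖u‖ = 1 → s (-u) = s u) : False := by
  obtain ⟨u₀, hu₀, hmin⟩ := (isCompact_sphere (0 : E) 1).exists_isMinOn
    (NormedSpace.sphere_nonempty.2 zero_le_one) hs.norm
  have hm : 0 < ‖s u₀‖ := norm_pos_iff.2 (hne _ (mem_sphere_zero_iff_norm.1 hu₀))
  obtain ⟨p, hp, hps⟩ := exists_contDiff_norm_sub_lt_of_continuousOn isClosed_sphere hs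
    (half_pos hm)
  let q : E → E := fun x => (2 : ℝ)⁻¹ • (p x + p (-x))
  have hq : ContDiff ℝ 1 q := contDiff_const.smul (hp.add (hp.comp contDiff_neg))
  have hqe : ∀ x, q (-x) = q x := fun x => by simp only [q, neg_neg, add_comm]
  have hqs : ∀ u, ‖u‖ = 1 → ‖q u - s u‖ < ‖s u₀‖ / 2 := by
    intro u hu
    have h1 := hps u (mem_sphere_zero_iff_norm.2 hu)
    have h2 := hps (-u) (mem_sphere_zero_iff_norm.2 (by rwa [norm_neg]))
    rw [he u hu] at h2
    calc ‖q u - s u‖ = ‖(2 : ℝ)⁻¹ • ((p u - s u) + (p (-u) - s u))‖ := by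
          congr 1
          simp only [q]
          module
      _ ≤ 2⁻¹ * (‖p u - s u‖ + ‖p (-u) - s u‖) := by
          rw [norm_smul, Real.norm_of_nonneg (by norm_num)]
          gcongr
          exact norm_add_le _ _
      _ < ‖s u₀‖ / 2 := by linarith
  refine not_exists_even_tangent_field_of_contDiff (w := fun x => q x - ⟪x, q x⟫ • x)
    (hq.sub ((contDiff_id.inner ℝ hq).smul contDiff_id)) ?_ ?_ ?_
  · intro u hu h0
    have h1 : ⟪s u, q u⟫ = 0 := by
      rw [sub_eq_zero.1 h0, inner_smul_right, real_inner_comm u (s u), ho u hu, mul_zero]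
    have h2 : ‖s u₀‖ ≤ ‖s u‖ := hmin (mem_sphere_zero_iff_norm.2 hu)
    have h3 : ‖s u‖ * ‖s u‖ ≤ ‖s u‖ * ‖q u - s u‖ := by
      have := abs_real_inner_le_norm (s u) (q u - s u)
      rwa [inner_sub_right, h1, zero_sub, abs_neg, real_inner_self_eq_norm_mul_norm,
        abs_of_nonneg (by positivity)] at this
    have h4 := le_of_mul_le_mul_left h3 (hm.trans_le h2)
    linarith [hqs u hu]
  · intro u hu
    simp only [inner_sub_right, inner_smul_right, real_inner_self_eq_norm_mul_norm, hu]
    ring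
  · intro u
    simp only [hqe, inner_neg_left, smul_neg, neg_smul, neg_neg]

theorem exists_mul_self_eq_near_one {A : Type*} [NormedRing A] [NormedAlgebra ℝ A]
    [CompleteSpace A] {U : Set A} (hU : U ∈ nhds (1 : A)) :
    ∀ᶠ h in nhds (1 : A), ∃ s ∈ U, s * s = h := by
  have hd : HasStrictFDerivAt (fun s : A => s * s) ((2 : ℝ) • ContinuousLinearMap.id ℝ A) 1 := by
    have := (hasStrictFDerivAt_id (𝕜 := ℝ) (1 : A)).mul' (hasStrictFDerivAt_id (𝕜 := ℝ) (1 : A))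
    refine this.congr_fderiv ?_
    ext x
    simp [two_smul]
  have hs : ((2 : ℝ) • ContinuousLinearMap.id ℝ A).range = ⊤ := by
    refine LinearMap.range_eq_top.2 fun x => ⟨(2 : ℝ)⁻¹ • x, ?_⟩
    simp
  have := hd.map_nhds_eq_of_surj hs
  rw [mul_one] at this
  have hm : (fun s : A => s * s) '' U ∈ nhds (1 : A) := this ▸ Filter.image_mem_map hU
  filter_upwards [hm] with h hh
  exact hh

theorem eventually_toEuclidean_sub_one_lt {A : Type*} [NormedRing A] [NormedAlgebra ℝ A]
    [FiniteDimensional ℝ A] [NormOneClass A] :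
    ∃ ε > 0, ∀ a s t : A, ‖a - 1‖ < ε → ‖s - 1‖ < ε → s ≠ 1 → s * t = 1 → t * s = 1 →
      2 * ‖toEuclidean (a - 1)‖ ^ 2 <
        ‖toEuclidean (a * s - 1)‖ ^ 2 + ‖toEuclidean (a * t - 1)‖ ^ 2 := by
  let τ : A ≃L[ℝ] EuclideanSpace ℝ (Fin (Module.finrank ℝ A)) := toEuclidean
  obtain ⟨C, hC0, hC⟩ : ∃ C > 0, ∀ x, ‖τ x‖ ≤ C * ‖x‖ :=
    (τ : A →L[ℝ] EuclideanSpace ℝ (Fin (Module.finrank ℝ A))).bound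
  obtain ⟨c, hc0, hc⟩ : ∃ C > 0, ∀ x, ‖τ.symm x‖ ≤ C * ‖x‖ :=
    (τ.symm : EuclideanSpace ℝ (Fin (Module.finrank ℝ A)) →L[ℝ] A).bound
  have hc' : ∀ x, ‖x‖ ≤ c * ‖τ x‖ := fun x => by simpa using hc (τ x)
  refine ⟨min (1 / 2) (1 / (16 * C ^ 2 * c ^ 2)), by positivity, ?_⟩
  intro a s t ha hs hs1 hst hts
  have ha2 := ha.trans_le (min_le_left _ _)
  have hs2 := hs.trans_le (min_le_left _ _)
  have ha3 := ha.trans_le (min_le_right _ _)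
  set e := s - 1 with he
  set X := a * e with hX
  set Y := X * e * t with hY
  set d := a - 1 with hd
  have he0 : 0 < ‖e‖ := norm_pos_iff.2 (sub_ne_zero.2 hs1)
  have h1 : a * s - 1 = d + X := by rw [hX, he, hd, mul_sub]; noncomm_ring
  have h2 : a * t - 1 = d + (Y - X) := by
    have : a * e * e * t = a * e * (s * t - t) := by rw [he]; noncomm_ring
    rw [hY, hX, this, hst]
    have : a * e * (1 - t) = a * e - a * (s * t - t) := by rw [he]; noncomm_ring
    rw [this, hst, hd]
    noncomm_ring
  have ht : ‖t‖ ≤ 2 := by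
    have : t = 1 - t * e := by rw [he, mul_sub, hts]; noncomm_ring
    have h3 : ‖t‖ ≤ 1 + ‖t‖ * (1 / 2) := by
      calc ‖t‖ = ‖1 - t * e‖ := by rw [← this]
        _ ≤ ‖(1 : A)‖ + ‖t * e‖ := norm_sub_le _ _
        _ ≤ 1 + ‖t‖ * ‖e‖ := by rw [norm_one]; gcongr; exact norm_mul_le _ _
        _ ≤ _ := by gcongr
    linarith
  have heX : ‖e‖ ≤ 2 * ‖X‖ := by
    have : e = X - d * e := by rw [hX, hd]; noncomm_ring
    have h3 : ‖e‖ ≤ ‖X‖ + 1 / 2 * ‖e‖ := by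
      calc ‖e‖ = ‖X - d * e‖ := by rw [← this]
        _ ≤ ‖X‖ + ‖d * e‖ := norm_sub_le _ _
        _ ≤ ‖X‖ + ‖d‖ * ‖e‖ := by gcongr; exact norm_mul_le _ _
        _ ≤ _ := by gcongr
    linarith
  have hXpos : 0 < ‖τ X‖ := by
    have := hc' X
    by_contra h
    have : ‖τ X‖ = 0 := le_antisymm (not_lt.1 h) (norm_nonneg _)
    have := hc' X
    rw [‹‖τ X‖ = 0›, mul_zero] at this
    linarith
  have hYX : ‖τ Y‖ ≤ 4 * C * c ^ 2 * ‖τ X‖ ^ 2 := by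
    calc ‖τ Y‖ ≤ C * ‖Y‖ := hC _
      _ ≤ C * (‖X‖ * ‖e‖ * ‖t‖) := by
          gcongr
          exact (norm_mul_le _ _).trans (by gcongr; exact norm_mul_le _ _)
      _ ≤ C * (‖X‖ * (2 * ‖X‖) * 2) := by gcongr
      _ = 4 * C * ‖X‖ ^ 2 := by ring
      _ ≤ 4 * C * (c * ‖τ X‖) ^ 2 := by gcongr; exact hc' X
      _ = _ := by ring
  have hdd : ‖τ d‖ ≤ C * (1 / (16 * C ^ 2 * c ^ 2)) := (hC d).trans (by gcongr)
  have hprod : 2 * (‖τ d‖ * ‖τ Y‖) ≤ ‖τ X‖ ^ 2 / 2 := by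
    calc 2 * (‖τ d‖ * ‖τ Y‖)
        ≤ 2 * (C * (1 / (16 * C ^ 2 * c ^ 2)) * (4 * C * c ^ 2 * ‖τ X‖ ^ 2)) := by gcongr
      _ = ‖τ X‖ ^ 2 / 2 := by field_simp; norm_num
  change 2 * ‖τ d‖ ^ 2 < ‖τ (a * s - 1)‖ ^ 2 + ‖τ (a * t - 1)‖ ^ 2
  rw [h1, h2, map_add τ d X, map_add τ d (Y - X), map_sub τ Y X, norm_add_sq_real,
    norm_add_sq_real, inner_sub_right]
  have h5 := neg_le_of_abs_le (abs_real_inner_le_norm (τ d) (τ Y))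
  nlinarith [sq_nonneg ‖τ Y - τ X‖, sq_pos_of_pos hXpos]

theorem exists_forall_eq_of_isMinOn_toEuclidean {A W : Type*} [NormedRing A] [NormedAlgebra ℝ A]
    [FiniteDimensional ℝ A] [NormOneClass A] [NormedAddCommGroup W] [NormedSpace ℝ W]
    {ρ : A →* (W →L[ℝ] W)} (hρ : Continuous ρ) :
    ∀ᶠ p : A × A in nhds (1, 1), ∀ T T' : W, ρ p.1 T = T' → ρ p.2 T = T' →
      (∀ a, ρ a T = T' → ‖toEuclidean (p.1 - 1)‖ ≤ ‖toEuclidean (a - 1)‖) →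
      (∀ a, ρ a T = T' → ‖toEuclidean (p.2 - 1)‖ ≤ ‖toEuclidean (a - 1)‖) → p.1 = p.2 := by
  have : CompleteSpace A := FiniteDimensional.complete ℝ A
  obtain ⟨ε, hε, H⟩ := eventually_toEuclidean_sub_one_lt (A := A)
  have hU : ∀ᶠ q : A × A in nhds (1, 1), ‖q.1 * q.2 - 1‖ < ε ∧ ‖q.2 - 1‖ < ε ∧
      IsUnit q.2 ∧ ‖ρ q.2 - 1‖ < 1 := by
    have h1 : Filter.Tendsto (fun q : A × A => ‖q.1 * q.2 - 1‖) (nhds (1, 1)) (nhds 0) := by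
      have : Continuous (fun q : A × A => ‖q.1 * q.2 - 1‖) := by fun_prop
      simpa using this.tendsto (1, 1)
    have h2 : Filter.Tendsto (fun q : A × A => ‖q.2 - 1‖) (nhds (1, 1)) (nhds 0) := by
      have : Continuous (fun q : A × A => ‖q.2 - 1‖) := by fun_prop
      simpa using this.tendsto (1, 1)
    have h3 : Filter.Tendsto (fun q : A × A => ‖ρ q.2 - 1‖) (nhds (1, 1)) (nhds 0) := by
      have : Continuous (fun q : A × A => ‖ρ q.2 - 1‖) := by fun_prop
      simpa using this.tendsto (1, 1)
    have h4 : ∀ᶠ q : A × A in nhds (1, 1), IsUnit q.2 :=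
      continuous_snd.continuousAt.eventually (Units.isOpen.mem_nhds isUnit_one)
    filter_upwards [h1.eventually_lt_const hε, h2.eventually_lt_const hε, h4,
      h3.eventually_lt_const one_pos] with q q1 q2 q3 q4
    exact ⟨q1, q2, q3, q4⟩
  rw [nhds_prod_eq, Filter.eventually_prod_iff] at hU
  obtain ⟨P, hP, Q, hQ, hPQ⟩ := hU
  have hsq := exists_mul_self_eq_near_one (A := A) hQ
  have hlim : Filter.Tendsto (fun p : A × A => Ring.inverse p.1 * p.2) (nhds (1, 1)) (nhds 1) := by
    have h1 : ContinuousAt (Ring.inverse : A → A) 1 := by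
      simpa using NormedRing.inverse_continuousAt (1 : Aˣ)
    have h2 : ContinuousAt (fun p : A × A => Ring.inverse p.1) (1, 1) :=
      ContinuousAt.comp (f := Prod.fst) (x := ((1 : A), (1 : A))) h1 continuous_fst.continuousAt
    have h3 : Filter.Tendsto (fun p : A × A => Ring.inverse p.1 * p.2) (nhds (1, 1))
        (nhds (Ring.inverse 1 * 1)) := h2.mul (continuous_snd (X := A) (Y := A)).continuousAt
    rwa [Ring.inverse_one, mul_one] at h3
  have hu : ∀ᶠ p : A × A in nhds (1, 1), IsUnit p.1 :=
    continuous_fst.continuousAt.eventually (Units.isOpen.mem_nhds isUnit_one)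
  have hP' : ∀ᶠ p : A × A in nhds (1, 1), P p.1 := continuous_fst.continuousAt.eventually hP
  filter_upwards [hlim.eventually hsq, hu, hP'] with p hp hpu hpP T T' h1 h2 m1 m2
  obtain ⟨s, hsQ, hs⟩ := hp
  obtain ⟨b1, b2, b3, b4⟩ := hPQ hpP hsQ
  by_contra hne
  have hp2 : p.2 = p.1 * s * s := by
    rw [mul_assoc, hs, Ring.mul_inverse_cancel_left _ _ hpu]
  have hs1 : s ≠ 1 := fun h => hne (by rw [hp2, h, mul_one, mul_one])
  have hstab : ρ (s * s) T = T := by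
    have h3 : ρ (Ring.inverse p.1 * p.1) T = T := by
      rw [Ring.inverse_mul_cancel _ hpu, map_one]
      rfl
    rw [hs, map_mul, mul_apply_eq_comp, h2, ← h1, ← mul_apply_eq_comp,
      ← map_mul, h3]
  have hsT : ρ s T = T := by
    rw [map_mul, mul_apply_eq_comp] at hstab
    have h3 : (ρ s - 1) (ρ s T - T) = (-2 : ℝ) • (ρ s T - T) := by
      simp only [sub_apply, one_apply_eq_self, map_sub, hstab]
      module
    have h4 := (ρ s - 1).le_opNorm (ρ s T - T)
    rw [h3, norm_smul] at h4
    norm_num at h4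
    have h5 : ‖ρ s T - T‖ = 0 := by
      nlinarith [norm_nonneg (ρ s T - T)]
    exact sub_eq_zero.1 (norm_eq_zero.1 h5)
  have ha : ρ (p.1 * s) T = T' := by rw [map_mul, mul_apply_eq_comp, hsT, h1]
  have hlt := H (p.1 * s) s (Ring.inverse s) b1 b2 hs1 (Ring.mul_inverse_cancel _ b3)
    (Ring.inverse_mul_cancel _ b3)
  rw [← hp2, Ring.mul_inverse_cancel_right _ _ b3] at hlt
  have := m1 _ ha
  have := m2 _ ha
  nlinarith [norm_nonneg (toEuclidean (p.1 - 1)), norm_nonneg (toEuclidean (p.2 - 1)),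
    norm_nonneg (toEuclidean (p.1 * s - 1))]

theorem exists_continuousAt_transition {A W S : Type*} [NormedRing A] [NormedAlgebra ℝ A]
    [FiniteDimensional ℝ A] [NormOneClass A] [NormedAddCommGroup W] [NormedSpace ℝ W]
    [UniformSpace S] [CompactSpace S] {ρ : A →* (W →L[ℝ] W)} (hρ : Continuous ρ)
    {T : S → W} (hT : Continuous T) {G : Set A} (hG : IsCompact G) (hGu : ∀ g ∈ G, IsUnit g)
    (htrans : ∀ u v, ∃ g, ρ g (T u) = T v) (hTG : ∀ u v g, ρ g (T u) = T v → g ∈ G) :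
    ∃ V ∈ uniformity S, ∃ Φ : S × S → A, (∀ p ∈ V, ContinuousAt Φ p) ∧
      ∀ p, ρ (Φ p) (T p.1) = T p.2 := by
  have : CompleteSpace A := FiniteDimensional.complete ℝ A
  let N : A → ℝ := fun a => ‖toEuclidean (a - 1)‖
  have hN : Continuous N := by
    have : Continuous (toEuclidean : A → _) := (toEuclidean (E := A)).continuous
    fun_prop
  have hN1 : N 1 = 0 := by simp [N]
  obtain ⟨c, hc0, hc⟩ : ∃ c > 0, ∀ a, ‖a - 1‖ ≤ c * N a := by
    obtain ⟨c, hc0, hc⟩ := (toEuclidean (E := A)).symm.toContinuousLinearMap.bound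
    exact ⟨c, hc0, fun a => by simpa [N] using hc (toEuclidean (a - 1))⟩
  have hρT : ∀ {l : Filter (S × S)} {f : S × S → A} {g : S × S → W} {a : A} {x : W},
      Filter.Tendsto f l (nhds a) → Filter.Tendsto g l (nhds x) →
      Filter.Tendsto (fun p => ρ (f p) (g p)) l (nhds (ρ a x)) := fun hf hg =>
    (isBoundedBilinearMap_apply.continuous.tendsto (ρ _, _)).comp
      (((hρ.tendsto _).comp hf).prodMk_nhds hg)
  have hmin : ∀ p : S × S, ∃ g, ρ g (T p.1) = T p.2 ∧ ∀ a, ρ a (T p.1) = T p.2 → N g ≤ N a := by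
    intro p
    have hcl : IsClosed {g | ρ g (T p.1) = T p.2} :=
      isClosed_eq (hρ.clm_apply continuous_const) continuous_const
    have hK : IsCompact {g | ρ g (T p.1) = T p.2} :=
      hG.of_isClosed_subset hcl fun g hg => hTG _ _ g hg
    obtain ⟨g, hg, hgm⟩ := hK.exists_isMinOn (htrans p.1 p.2) hN.continuousOn
    exact ⟨g, hg, fun a ha => hgm ha⟩
  choose Φ hΦ hΦmin using hmin
  have hΦG : ∀ p, Φ p ∈ G := fun p => hTG _ _ _ (hΦ p)
  have hcomp : ∀ {g h : A} {x y z : W}, ρ g x = y → ρ h y = z → ρ (h * g) x = z := by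
    intro g h x y z h1 h2
    rw [map_mul, mul_apply_eq_comp, h1, h2]
  have hinv : ∀ {g : A} {x y : W}, IsUnit g → ρ g x = y → ρ (Ring.inverse g) y = x := by
    intro g x y hg h
    rw [← h, ← mul_apply_eq_comp, ← map_mul, Ring.inverse_mul_cancel _ hg, map_one,
      one_apply_eq_self]
  have hone : Filter.Tendsto Φ (uniformity S) (nhds 1) := by
    rw [Filter.tendsto_iff_ultrafilter]
    intro U hU
    obtain ⟨a, -, ha⟩ := isCompact_univ.ultrafilter_le_nhds (U.map Prod.fst) (by simp)
    replace ha : Filter.Tendsto Prod.fst (U : Filter (S × S)) (nhds a) := ha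
    have ha' : Filter.Tendsto Prod.snd (U : Filter (S × S)) (nhds a) := ha.congr_uniformity hU
    have hcpt : ∀ f : S × S → A, (∀ p, f p ∈ G) →
        ∃ γ ∈ G, Filter.Tendsto f (U : Filter (S × S)) (nhds γ) := fun f hf =>
      hG.ultrafilter_le_nhds (U.map f)
        (Filter.le_principal_iff.2 (Filter.mem_map.2 (Filter.univ_mem' hf)))
    obtain ⟨γ, hγ, hγlim⟩ := hcpt (fun p => Φ (a, p.2)) fun p => hΦG _
    obtain ⟨δ, hδ, hδlim⟩ := hcpt (fun p => Φ (p.1, a)) fun p => hΦG _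
    have h1 : ρ γ (T a) = T a := by
      refine tendsto_nhds_unique (hρT hγlim tendsto_const_nhds) ?_
      exact ((hT.tendsto a).comp ha').congr fun p => (hΦ (a, p.2)).symm
    have h2 : ρ δ (T a) = T a := by
      refine tendsto_nhds_unique (hρT hδlim ((hT.tendsto a).comp ha)) ?_
      exact tendsto_const_nhds.congr fun p => (hΦ (p.1, a)).symm
    have h3 : ρ (Ring.inverse γ * Ring.inverse δ) (T a) = T a :=
      hcomp (hinv (hGu _ hδ) h2) (hinv (hGu _ hγ) h1)
    have hlim : Filter.Tendsto
        (fun p : S × S => N (Φ (a, p.2) * (Ring.inverse γ * Ring.inverse δ) * Φ (p.1, a)))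
        U (nhds 0) := by
      have h4 : γ * (Ring.inverse γ * Ring.inverse δ) * δ = 1 := by
        rw [Ring.mul_inverse_cancel_left _ _ (hGu _ hγ), Ring.inverse_mul_cancel _ (hGu _ hδ)]
      have := (hN.tendsto _).comp ((hγlim.mul_const (Ring.inverse γ * Ring.inverse δ)).mul hδlim)
      rwa [h4, hN1] at this
    refine tendsto_iff_norm_sub_tendsto_zero.2 ?_
    refine squeeze_zero (fun _ => norm_nonneg _)
      (fun p => (hc (Φ p)).trans (mul_le_mul_of_nonneg_left (hΦmin p _ ?_) hc0.le))
      (by simpa using hlim.const_mul c)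
    exact hcomp (hΦ (p.1, a)) (hcomp h3 (hΦ (a, p.2)))
  have huniq := exists_forall_eq_of_isMinOn_toEuclidean hρ
  rw [nhds_prod_eq, Filter.eventually_prod_self_iff'] at huniq
  obtain ⟨t, ht, huniq⟩ := huniq
  obtain ⟨r, hr, hrt⟩ := Metric.mem_nhds_iff.1 ht
  have hNt : ∀ a, N a < r / c → a ∈ t := by
    intro a ha
    refine hrt ?_
    rw [mem_ball_iff_norm]
    exact (hc a).trans_lt (by rwa [lt_div_iff₀' hc0] at ha)
  have hVm : ∀ᶠ p in uniformity S, N (Φ p) < r / c := by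
    have := (hN.tendsto 1).comp hone
    rw [hN1] at this
    exact this.eventually_lt_const (div_pos hr hc0)
  refine ⟨{p | N (Φ p) < r / c}, hVm, Φ, ?_, hΦ⟩
  intro p hp
  refine hG.tendsto_nhds_of_unique_mapClusterPt (Filter.Eventually.of_forall hΦG) ?_
  intro γ hγ hcl
  obtain ⟨U, hU, hUlim⟩ := mapClusterPt_iff_ultrafilter.1 hcl
  have hfst : Filter.Tendsto Prod.fst (U : Filter (S × S)) (nhds p.1) :=
    (continuous_fst.tendsto p).mono_left hU
  have hsnd : Filter.Tendsto Prod.snd (U : Filter (S × S)) (nhds p.2) :=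
    (continuous_snd.tendsto p).mono_left hU
  have hγp : ρ γ (T p.1) = T p.2 := by
    refine tendsto_nhds_unique (hρT hUlim ((hT.tendsto _).comp hfst)) ?_
    exact ((hT.tendsto _).comp hsnd).congr fun q => (hΦ q).symm
  have h1 : Filter.Tendsto (fun q : S × S => Φ (q.1, p.1)) U (nhds 1) :=
    hone.comp (Uniform.tendsto_nhds_left.1 hfst)
  have h2 : Filter.Tendsto (fun q : S × S => Φ (p.2, q.2)) U (nhds 1) :=
    hone.comp (Uniform.tendsto_nhds_right.1 hsnd)
  have hlim : Filter.Tendsto (fun q : S × S => N (Φ (p.2, q.2) * Φ p * Φ (q.1, p.1))) U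
      (nhds (N (Φ p))) := by
    have := (hN.tendsto _).comp ((h2.mul_const (Φ p)).mul h1)
    rwa [one_mul, mul_one] at this
  have hle : N γ ≤ N (Φ p) :=
    le_of_tendsto_of_tendsto' ((hN.tendsto _).comp hUlim) hlim fun q =>
      hΦmin q _ (hcomp (hΦ (q.1, p.1)) (hcomp (hΦ p) (hΦ (p.2, q.2))))
  exact huniq γ (hNt _ (hle.trans_lt hp)) (Φ p) (hNt _ hp) _ _ hγp (hΦ p)
    (fun a ha => hle.trans (hΦmin p a ha)) (hΦmin p)

theorem exists_continuous_lift {A W S X : Type*} [NormedRing A] [NormedAlgebra ℝ A]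
    [FiniteDimensional ℝ A] [NormOneClass A] [NormedAddCommGroup W] [NormedSpace ℝ W]
    [UniformSpace S] [CompactSpace S] [PseudoMetricSpace X] [CompactSpace X]
    {ρ : A →* (W →L[ℝ] W)} (hρ : Continuous ρ)
    {T : S → W} (hT : Continuous T) {G : Set A} (hG : IsCompact G) (hGu : ∀ g ∈ G, IsUnit g)
    (htrans : ∀ u v, ∃ g, ρ g (T u) = T v) (hTG : ∀ u v g, ρ g (T u) = T v → g ∈ G)
    {H : ℝ × X → S} (hH : Continuous H) {s₀ : S} (hH0 : ∀ x, H (0, x) = s₀) :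
    ∃ g : X → A, Continuous g ∧ ∀ x, ρ (g x) (T s₀) = T (H (1, x)) := by
  obtain ⟨V, hV, Φ, hΦc, hΦ⟩ := exists_continuousAt_transition hρ hT hG hGu htrans hTG
  have hK : IsCompact (Set.Icc (0 : ℝ) 1 ×ˢ (Set.univ : Set X)) := isCompact_Icc.prod isCompact_univ
  have hunif := hK.uniformContinuousOn_of_continuous hH.continuousOn
  have hmem := hunif hV
  obtain ⟨δ, hδ, hδV⟩ : ∃ δ > 0, ∀ p ∈ Set.Icc (0 : ℝ) 1 ×ˢ (Set.univ : Set X),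
      ∀ q ∈ Set.Icc (0 : ℝ) 1 ×ˢ (Set.univ : Set X), dist p q < δ → (H p, H q) ∈ V := by
    rw [Filter.mem_map, Filter.mem_inf_principal, Metric.mem_uniformity_dist] at hmem
    obtain ⟨δ, hδ, h⟩ := hmem
    exact ⟨δ, hδ, fun p hp q hq hpq => h hpq ⟨hp, hq⟩⟩
  obtain ⟨N, hN⟩ := exists_nat_one_div_lt hδ
  have hN0 : (0 : ℝ) < N + 1 := by positivity
  have key : ∀ i : ℕ, i ≤ N + 1 →
      ∃ g : X → A, Continuous g ∧ ∀ x, ρ (g x) (T s₀) = T (H (i / (N + 1 : ℝ), x)) := by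
    intro i
    induction i with
    | zero =>
      intro _
      refine ⟨fun _ => 1, continuous_const, fun x => ?_⟩
      simp [hH0]
    | succ i ih =>
      intro hi
      obtain ⟨g, hg, hgT⟩ := ih (by omega)
      have hiN : (i : ℝ) + 1 ≤ N + 1 := by exact_mod_cast hi
      have hmemV : ∀ x, (H (i / (N + 1 : ℝ), x), H ((i + 1 : ℕ) / (N + 1 : ℝ), x)) ∈ V := by
        intro x
        refine hδV _ ⟨⟨by positivity, ?_⟩, trivial⟩ _ ⟨⟨by positivity, ?_⟩, trivial⟩ ?_
        · exact (div_le_one hN0).2 (by linarith)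
        · push_cast
          exact (div_le_one hN0).2 hiN
        · rw [Prod.dist_eq, dist_self, max_eq_left dist_nonneg, Real.dist_eq]
          push_cast
          rw [← sub_div, abs_div, abs_of_pos hN0]
          simpa using hN
      have hc : ∀ t : ℝ, Continuous fun x => H (t, x) := fun t =>
        hH.comp (continuous_const.prodMk continuous_id)
      refine ⟨fun x => Φ (H (i / (N + 1 : ℝ), x), H ((i + 1 : ℕ) / (N + 1 : ℝ), x)) * g x,
        Continuous.mul ?_ hg, fun x => ?_⟩
      · refine continuous_iff_continuousAt.2 fun x => ?_
        exact ContinuousAt.comp (f := fun x =>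
          (H (i / (N + 1 : ℝ), x), H ((i + 1 : ℕ) / (N + 1 : ℝ), x)))
          (hΦc _ (hmemV x)) ((hc _).prodMk (hc _)).continuousAt
      · rw [map_mul, mul_apply_eq_comp, hgT]
        exact hΦ (H (i / (N + 1 : ℝ), x), H ((i + 1 : ℕ) / (N + 1 : ℝ), x))
  obtain ⟨g, hg, hgT⟩ := key (N + 1) le_rfl
  refine ⟨g, hg, fun x => ?_⟩
  have := hgT x
  push_cast at this
  rwa [div_self hN0.ne'] at this

theorem exists_continuous_contraction_sphere {E : Type*} [NormedAddCommGroup E]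
    [InnerProductSpace ℝ E] (e : sphere (0 : E) 1) (X : Set E) (hX : X ⊆ sphere 0 1)
    (heX : -(e : E) ∉ X) :
    ∃ H : ℝ × X → sphere (0 : E) 1, Continuous H ∧ (∀ x, H (0, x) = e) ∧
      ∀ x, (H (1, x) : E) = x := by
  let L : ℝ × X → E := fun p => (1 - p.1) • (e : E) + p.1 • (p.2 : E)
  have hL : Continuous L := by fun_prop
  have hL0 : ∀ p, L p ≠ 0 := by
    rintro ⟨t, x⟩ h
    have hx : ‖(x : E)‖ = 1 := mem_sphere_zero_iff_norm.1 (hX x.2)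
    have he : ‖(e : E)‖ = 1 := mem_sphere_zero_iff_norm.1 e.2
    have h1 : (1 - t) • (e : E) = -(t • (x : E)) := eq_neg_of_add_eq_zero_left h
    have h2 := congrArg norm h1
    rw [norm_neg, norm_smul, norm_smul, hx, he, mul_one, mul_one, Real.norm_eq_abs,
      Real.norm_eq_abs, abs_eq_abs] at h2
    have ht : t = 1 / 2 := by rcases h2 with h2 | h2 <;> linarith
    rw [ht] at h1
    have h3 : (1 / 2 : ℝ) • (-(e : E)) = (1 / 2 : ℝ) • (x : E) := by
      rw [smul_neg, neg_eq_iff_eq_neg, ← h1]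
      norm_num
    have h4 : -(e : E) = x := smul_right_injective E (by norm_num : (1 / 2 : ℝ) ≠ 0) h3
    exact heX (h4 ▸ x.2)
  refine ⟨fun p => ⟨‖L p‖⁻¹ • L p, ?_⟩, ?_, ?_, ?_⟩
  · exact mem_sphere_zero_iff_norm.2 (norm_smul_inv_norm (𝕜 := ℝ) (hL0 p))
  · exact ((hL.norm.inv₀ fun p => norm_ne_zero_iff.2 (hL0 p)).smul hL).subtype_mk _
  · intro x
    ext
    simp [L]
  · intro x
    have hx : ‖(x : E)‖ = 1 := mem_sphere_zero_iff_norm.1 (hX x.2)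
    simp [L, hx]

/-- The action of operators on multilinear forms by precomposition with the adjoint. -/
noncomputable def adjointCompHom (E : Type*) [NormedAddCommGroup E] [InnerProductSpace ℝ E]
    [CompleteSpace E] (m : ℕ) : (E →L[ℝ] E) →* ((E [×m]→L[ℝ] ℝ) →L[ℝ] (E [×m]→L[ℝ] ℝ)) where
  toFun g := ContinuousMultilinearMap.compContinuousLinearMapContinuousMultilinear ℝ
    (fun _ : Fin m => E) (fun _ : Fin m => E) ℝ fun _ => ContinuousLinearMap.adjoint g
  map_one' := by
    ext M w
    simp [← ContinuousLinearMap.star_eq_adjoint,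
      ContinuousMultilinearMap.compContinuousLinearMapContinuousMultilinear,
      ContinuousMultilinearMap.compContinuousLinearMapMultilinear,
      ContinuousMultilinearMap.compContinuousLinearMapL]
  map_mul' g h := by
    ext M w
    simp [← ContinuousLinearMap.star_eq_adjoint,
      ContinuousMultilinearMap.compContinuousLinearMapContinuousMultilinear,
      ContinuousMultilinearMap.compContinuousLinearMapMultilinear,
      ContinuousMultilinearMap.compContinuousLinearMapL]

theorem adjointCompHom_apply {E : Type*} [NormedAddCommGroup E] [InnerProductSpace ℝ E]
    [CompleteSpace E] {m : ℕ} (g : E →L[ℝ] E) (M : E [×m]→L[ℝ] ℝ) (w : Fin m → E) :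
    adjointCompHom E m g M w = M fun i => ContinuousLinearMap.adjoint g (w i) := rfl

theorem continuous_adjointCompHom (E : Type*) [NormedAddCommGroup E] [InnerProductSpace ℝ E]
    [CompleteSpace E] (m : ℕ) : Continuous (adjointCompHom E m) :=
  (ContinuousMultilinearMap.compContinuousLinearMapContinuousMultilinear ℝ
    (fun _ : Fin m => E) (fun _ : Fin m => E) ℝ).cont.comp
    (continuous_pi fun _ => ContinuousLinearMap.adjoint.continuous)

/-- The diagonal action on a vector and two multilinear forms. -/
noncomputable def adjointCompProdHom (E : Type*) [NormedAddCommGroup E] [InnerProductSpace ℝ E]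
    [CompleteSpace E] (k m : ℕ) : (E →L[ℝ] E) →*
      ((E × (E [×k]→L[ℝ] ℝ) × (E [×m]→L[ℝ] ℝ)) →L[ℝ] (E × (E [×k]→L[ℝ] ℝ) × (E [×m]→L[ℝ] ℝ))) where
  toFun g := g.prodMap ((adjointCompHom E k g).prodMap (adjointCompHom E m g))
  map_one' := by
    ext x <;> simp
  map_mul' g h := by
    ext x <;> simp

theorem continuous_adjointCompProdHom (E : Type*) [NormedAddCommGroup E] [InnerProductSpace ℝ E]
    [CompleteSpace E] (k m : ℕ) : Continuous (adjointCompProdHom E k m) := by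
  have h1 := continuous_adjointCompHom E k
  have h2 := continuous_adjointCompHom E m
  exact continuous_id.prod_mapL ℝ (h1.prod_mapL ℝ h2)

theorem isCompact_setOf_adjoint_bounds {E : Type*} [NormedAddCommGroup E] [InnerProductSpace ℝ E]
    [FiniteDimensional ℝ E] {α β : ℝ} (hα : 0 < α) :
    IsCompact {g : E →L[ℝ] E | ∀ w, α * ‖w‖ ^ 2 ≤ β * ‖ContinuousLinearMap.adjoint g w‖ ^ 2 ∧
      α * ‖ContinuousLinearMap.adjoint g w‖ ^ 2 ≤ β * ‖w‖ ^ 2} := by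
  refine Metric.isCompact_of_isClosed_isBounded ?_ ?_
  · simp only [Set.ofPred_forall]
    refine isClosed_iInter fun w => ?_
    have hc : Continuous fun g : E →L[ℝ] E => ContinuousLinearMap.adjoint g w :=
      ContinuousLinearMap.adjoint.continuous.clm_apply continuous_const
    exact (isClosed_le continuous_const (continuous_const.mul (hc.norm.pow 2))).inter
      (isClosed_le (continuous_const.mul (hc.norm.pow 2)) continuous_const)
  · refine isBounded_iff_forall_norm_le.2 ⟨√(|β| / α), fun g hg => ?_⟩
    rw [← ContinuousLinearMap.adjoint.norm_map g]
    refine ContinuousLinearMap.opNorm_le_bound _ (Real.sqrt_nonneg _) fun w => ?_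
    refine abs_le_of_sq_le_sq' ?_ (by positivity) |>.2
    rw [mul_pow, Real.sq_sqrt (by positivity), div_mul_eq_mul_div, le_div_iff₀' hα]
    exact (hg w).2.trans (by gcongr; exact le_abs_self β)

theorem isUnit_of_adjoint_bounds {E : Type*} [NormedAddCommGroup E] [InnerProductSpace ℝ E]
    [FiniteDimensional ℝ E] {α β : ℝ} (hα : 0 < α) {g : E →L[ℝ] E}
    (hg : ∀ w, α * ‖w‖ ^ 2 ≤ β * ‖ContinuousLinearMap.adjoint g w‖ ^ 2) : IsUnit g := by
  rw [← isUnit_star, ContinuousLinearMap.star_eq_adjoint,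
    ContinuousLinearMap.isUnit_iff_bijective]
  have hinj : Function.Injective (ContinuousLinearMap.adjoint g) := by
    refine (injective_iff_map_eq_zero _).2 fun w hw => ?_
    have := hg w
    rw [hw, norm_zero] at this
    have h2 : ‖w‖ ^ 2 ≤ 0 := by
      by_contra h
      nlinarith [mul_pos hα (not_le.1 h)]
    simpa using le_antisymm h2 (sq_nonneg _)
  exact ⟨hinj, (LinearMap.injective_iff_surjective
    (f := (ContinuousLinearMap.adjoint g : E →ₗ[ℝ] E))).1 hinj⟩

theorem exists_bounds_of_continuous_posDef {E : Type*} [NormedAddCommGroup E]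
    [InnerProductSpace ℝ E] [FiniteDimensional ℝ E] [Nontrivial E]
    {C : sphere (0 : E) 1 → E [×2]→L[ℝ] ℝ} (hC : Continuous C)
    (hpos : ∀ u w, w ≠ 0 → 0 < C u fun _ => w) :
    ∃ α > 0, ∃ β, ∀ u w, α * ‖w‖ ^ 2 ≤ C u (fun _ => w) ∧ C u (fun _ => w) ≤ β * ‖w‖ ^ 2 := by
  let f : sphere (0 : E) 1 × sphere (0 : E) 1 → ℝ := fun p => C p.1 fun _ => p.2
  have hf : Continuous f := by
    have : Continuous fun p : (E [×2]→L[ℝ] ℝ) × (Fin 2 → E) => p.1 p.2 := continuous_eval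
    exact this.comp ((hC.comp continuous_fst).prodMk
      (continuous_pi fun _ => continuous_subtype_val.comp continuous_snd))
  have : Nonempty (sphere (0 : E) 1) := (NormedSpace.sphere_nonempty.2 zero_le_one).to_subtype
  obtain ⟨p, -, hp⟩ := isCompact_univ.exists_isMinOn Set.univ_nonempty hf.continuousOn
  obtain ⟨q, -, hq⟩ := isCompact_univ.exists_isMaxOn Set.univ_nonempty hf.continuousOn
  have hhom : ∀ u w, w ≠ 0 → ∃ v, (C u fun _ => w) = f (u, v) * ‖w‖ ^ 2 := by
    intro u w hw
    refine ⟨⟨‖w‖⁻¹ • w, mem_sphere_zero_iff_norm.2 (norm_smul_inv_norm (𝕜 := ℝ) hw)⟩, ?_⟩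
    have := (C u).map_smul_univ (fun _ => ‖w‖⁻¹) (fun _ => w)
    simp only [f]
    rw [this]
    have := norm_ne_zero_iff.2 hw
    simp only [Fin.prod_univ_two, smul_eq_mul]
    field_simp
  refine ⟨f p, hpos _ _ (ne_zero_of_mem_unit_sphere p.2), f q, fun u w => ?_⟩
  rcases eq_or_ne w 0 with rfl | hw
  · have : (C u fun _ => (0 : E)) = 0 := (C u).map_coord_zero 0 rfl
    simp [this]
  · obtain ⟨v, hv⟩ := hhom u w hw
    rw [hv]
    exact ⟨mul_le_mul_of_nonneg_right (hp trivial) (sq_nonneg _),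
      mul_le_mul_of_nonneg_right (hq trivial) (sq_nonneg _)⟩

theorem forall_odd_form_nonpos_of_transitive {E : Type*} [NormedAddCommGroup E]
    [InnerProductSpace ℝ E] [FiniteDimensional ℝ E] [Nontrivial E] {m : ℕ} (hm : Odd m)
    {C : sphere (0 : E) 1 → E [×2]→L[ℝ] ℝ} (hC : Continuous C)
    (hpos : ∀ u w, w ≠ 0 → 0 < C u fun _ => w)
    {M : sphere (0 : E) 1 → E [×m]→L[ℝ] ℝ} (hM : Continuous M) (heven : ∀ u, M (-u) = M u)
    (htrans : ∀ u v : sphere (0 : E) 1, ∃ g : E →L[ℝ] E, g u = v ∧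
      (∀ w, C v w = C u fun i => ContinuousLinearMap.adjoint g (w i)) ∧
      ∀ w, M v w = M u fun i => ContinuousLinearMap.adjoint g (w i))
    (u₀ : sphere (0 : E) 1) (w₀ : E) (hw₀ : ⟪(u₀ : E), w₀⟫ = 0) : (M u₀ fun _ => w₀) ≤ 0 := by
  by_contra hq
  push Not at hq
  obtain ⟨α, hα, β, hαβ⟩ := exists_bounds_of_continuous_posDef hC hpos
  let T : sphere (0 : E) 1 → E × (E [×2]→L[ℝ] ℝ) × (E [×m]→L[ℝ] ℝ) := fun u => (u, C u, M u)
  have hT : Continuous T := continuous_subtype_val.prodMk (hC.prodMk hM)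
  have hρ := continuous_adjointCompProdHom E 2 m
  have hact : ∀ u v g, adjointCompProdHom E 2 m g (T u) = T v ↔ g u = v ∧
      (∀ w, C v w = C u fun i => ContinuousLinearMap.adjoint g (w i)) ∧
      ∀ w, M v w = M u fun i => ContinuousLinearMap.adjoint g (w i) := by
    intro u v g
    change (g u, adjointCompHom E 2 g (C u), adjointCompHom E m g (M u)) = (↑v, C v, M v) ↔ _
    rw [Prod.mk_inj, Prod.mk_inj, ContinuousMultilinearMap.ext_iff,
      ContinuousMultilinearMap.ext_iff]
    simp only [adjointCompHom_apply, eq_comm]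
  have hbd : ∀ u v g, adjointCompProdHom E 2 m g (T u) = T v → ∀ w,
      α * ‖w‖ ^ 2 ≤ β * ‖ContinuousLinearMap.adjoint g w‖ ^ 2 ∧
      α * ‖ContinuousLinearMap.adjoint g w‖ ^ 2 ≤ β * ‖w‖ ^ 2 := by
    intro u v g hg w
    have h1 := ((hact u v g).1 hg).2.1 fun _ => w
    have h2 := hαβ v w
    have h3 := hαβ u (ContinuousLinearMap.adjoint g w)
    rw [h1] at h2
    exact ⟨h2.1.trans h3.2, h3.1.trans h2.2⟩
  let X : Set E := {u | ‖u‖ = 1 ∧ -(1 / 2) ≤ ⟪u, (u₀ : E)⟫}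
  have hu₀ : ‖(u₀ : E)‖ = 1 := mem_sphere_zero_iff_norm.1 u₀.2
  have hXs : X ⊆ sphere 0 1 := fun u hu => mem_sphere_zero_iff_norm.2 hu.1
  have hXcl : IsClosed X := by
    refine (isClosed_eq continuous_norm continuous_const).inter
      (isClosed_le continuous_const (by fun_prop : Continuous fun u : E => ⟪u, (u₀ : E)⟫))
  have hXc : IsCompact X := (isCompact_sphere 0 1).of_isClosed_subset hXcl hXs
  have : CompactSpace X := isCompact_iff_compactSpace.1 hXc
  obtain ⟨H, hH, hH0, hH1⟩ := exists_continuous_contraction_sphere u₀ X hXs (by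
    rintro ⟨-, h⟩
    rw [inner_neg_left, real_inner_self_eq_norm_sq, hu₀] at h
    norm_num at h)
  obtain ⟨g, hg, hgT⟩ := exists_continuous_lift hρ hT (isCompact_setOf_adjoint_bounds hα)
    (fun g hg => isUnit_of_adjoint_bounds hα fun w => (hg w).1)
    (fun u v => by
      obtain ⟨g, h⟩ := htrans u v
      exact ⟨g, (hact u v g).2 h⟩) hbd hH hH0
  have hgu : ∀ x, IsUnit (g x) := fun x =>
    isUnit_of_adjoint_bounds hα fun w => (hbd _ _ _ (hgT x) w).1
  let w : E → E := fun u => open Classical in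
    if h : u ∈ X then ContinuousLinearMap.adjoint (Ring.inverse (g ⟨u, h⟩)) w₀ else 0
  have hwX : ∀ x : X, w x = ContinuousLinearMap.adjoint (Ring.inverse (g x)) w₀ := fun x => by
    simp only [w, x.2, dite_true]
  have hwX' : ∀ u ∉ X, w u = 0 := fun u hu => by simp only [w, hu, dite_false]
  have hwc : ContinuousOn w X := by
    rw [continuousOn_iff_continuous_domRestrict]
    have h1 : Continuous fun x : X => ContinuousLinearMap.adjoint (Ring.inverse (g x)) w₀ := by
      have h2 : Continuous fun x : X => Ring.inverse (g x) := by
        refine continuous_iff_continuousAt.2 fun x => ?_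
        obtain ⟨y, hy⟩ := hgu x
        exact ContinuousAt.comp (f := g) (hy ▸ NormedRing.inverse_continuousAt y) hg.continuousAt
      exact (ContinuousLinearMap.adjoint.continuous.comp h2).clm_apply continuous_const
    exact h1.congr fun x => (hwX x).symm
  have hwo : ∀ u, ⟪u, w u⟫ = 0 := by
    intro u
    by_cases hu : u ∈ X
    · rw [show w u = _ from hwX ⟨u, hu⟩, ContinuousLinearMap.adjoint_inner_right]
      have h1 : g ⟨u, hu⟩ u₀ = u :=
        ((hact _ _ _).1 (hgT ⟨u, hu⟩)).1.trans (hH1 ⟨u, hu⟩)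
      have h2 : Ring.inverse (g ⟨u, hu⟩) u = u₀ := by
        have h3 := congrArg (Ring.inverse (g ⟨u, hu⟩) : E →L[ℝ] E) h1
        rw [← mul_apply_eq_comp, Ring.inverse_mul_cancel _ (hgu _), one_apply_eq_self] at h3
        exact h3.symm
      rw [h2, hw₀]
    · rw [hwX' u hu, inner_zero_right]
  have hwM : ∀ u (hu : u ∈ X), (M ⟨u, hXs hu⟩ fun _ => w u) = M u₀ fun _ => w₀ := by
    intro u hu
    have h1 : H (1, ⟨u, hu⟩) = ⟨u, hXs hu⟩ := Subtype.ext (hH1 ⟨u, hu⟩)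
    have h2 := ((hact _ _ _).1 (hgT ⟨u, hu⟩)).2.2 fun _ => w u
    rw [h1] at h2
    rw [h2]
    congr 1
    ext i : 1
    rw [show w u = _ from hwX ⟨u, hu⟩, ← mul_apply_eq_comp, ← ContinuousLinearMap.star_eq_adjoint,
      ← ContinuousLinearMap.star_eq_adjoint, ← star_mul, Ring.inverse_mul_cancel _ (hgu _),
      star_one, one_apply_eq_self]
  let a : E → ℝ := fun u => max 0 (⟪u, (u₀ : E)⟫ + 1 / 4)
  have ha : Continuous a := by fun_prop
  have ha0 : ∀ u, 0 ≤ a u := fun u => le_max_left _ _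
  have haX : ∀ u, ‖u‖ = 1 → 0 < a u → u ∈ X := by
    intro u hu h
    refine ⟨hu, ?_⟩
    by_contra h'
    have : a u = 0 := max_eq_left (by linarith)
    exact h.ne' this
  have hawc : ContinuousOn (fun u => a u • w u) (sphere 0 1) := by
    have h1 : ContinuousOn (fun u => a u • w u) X := ha.continuousOn.smul hwc
    let Y : Set E := {u | ⟪u, (u₀ : E)⟫ ≤ -(1 / 4)}
    have hY : IsClosed Y := isClosed_le (by fun_prop) continuous_const
    have h2 : ContinuousOn (fun u => a u • w u) Y := by
      refine (continuousOn_const (c := (0 : E))).congr fun u hu => ?_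
      have : a u = 0 := max_eq_left (by linarith [show ⟪u, (u₀ : E)⟫ ≤ -(1 / 4) from hu])
      simp only [this, zero_smul]
    refine (h1.union_of_isClosed h2 hXcl hY).mono fun u hu => ?_
    rcases le_total (-(1 / 2)) ⟪u, (u₀ : E)⟫ with h | h
    · exact Or.inl ⟨mem_sphere_zero_iff_norm.1 hu, h⟩
    · exact Or.inr (h.trans (by norm_num))
  have hQ : ∀ (u : sphere (0 : E) 1) (c : ℝ), |c| = a u →
      (M u fun _ => c • w u) = c ^ m * M u₀ fun _ => w₀ := by
    intro u c hc
    have h1 := (M u).map_smul_univ (fun _ => c) (fun _ => w u)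
    rw [h1]
    simp only [Finset.prod_const, Finset.card_univ, Fintype.card_fin, smul_eq_mul]
    rcases (ha0 u).eq_or_lt with h | h
    · have : c = 0 := abs_eq_zero.1 (hc.trans h.symm)
      rw [this, zero_pow hm.pos.ne', zero_mul, zero_mul]
    · rw [← hwM u (haX u (mem_sphere_zero_iff_norm.1 u.2) h)]
  refine not_exists_even_tangent_field (s := fun u => a u • w u + a (-u) • w (-u)) ?_ ?_ ?_ ?_
  · refine hawc.add (hawc.comp continuous_neg.continuousOn fun u hu => ?_)
    simpa using hu
  · intro u hu h0
    let v : sphere (0 : E) 1 := ⟨u, mem_sphere_zero_iff_norm.2 hu⟩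
    have h1 : a u • w u = (-a (-u)) • w (-u) := by
      rw [neg_smul]
      exact eq_neg_of_add_eq_zero_left h0
    have h2 := hQ v (a u) (abs_of_nonneg (ha0 u))
    have h3 := hQ (-v) (-a (-u)) (by rw [abs_neg]; exact abs_of_nonneg (ha0 _))
    rw [heven v] at h3
    have h4 : (M v fun _ => a u • w u) = M v fun _ => (-a (-u)) • w (-u) := by rw [h1]
    have h5 : (a u) ^ m * (M u₀ fun _ => w₀) = (-a (-u)) ^ m * M u₀ fun _ => w₀ :=
      h2.symm.trans (h4.trans h3)
    have h6 := mul_right_cancel₀ hq.ne' h5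
    rw [hm.neg_pow] at h6
    have h7 : 0 ≤ a u ^ m := pow_nonneg (ha0 _) _
    have h8 : 0 ≤ a (-u) ^ m := pow_nonneg (ha0 _) _
    have h9 : a u = 0 := eq_zero_of_pow_eq_zero (n := m) (by linarith)
    have h10 : a (-u) = 0 := eq_zero_of_pow_eq_zero (n := m) (by linarith)
    have h11 : ⟪u, (u₀ : E)⟫ + 1 / 4 ≤ 0 := h9 ▸ le_max_right 0 (⟪u, (u₀ : E)⟫ + 1 / 4)
    have h12 : ⟪-u, (u₀ : E)⟫ + 1 / 4 ≤ 0 := h10 ▸ le_max_right 0 (⟪-u, (u₀ : E)⟫ + 1 / 4)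
    rw [inner_neg_left] at h12
    linarith
  · intro u hu
    have h1 := hwo (-u)
    rw [inner_neg_left, neg_eq_zero] at h1
    rw [inner_add_right, inner_smul_right, inner_smul_right, hwo, h1]
    simp
  · intro u hu
    simp only [neg_neg, add_comm]

/-- The `m`-th tensor power of the functional `⟪y, ·⟫`. -/
noncomputable def innerPow {E : Type*} [NormedAddCommGroup E] [InnerProductSpace ℝ E] (m : ℕ)
    (y : E) : E [×m]→L[ℝ] ℝ :=
  (ContinuousMultilinearMap.mkPiAlgebra ℝ (Fin m) ℝ).compContinuousLinearMap fun _ => innerSL ℝ y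

theorem innerPow_apply {E : Type*} [NormedAddCommGroup E] [InnerProductSpace ℝ E] {m : ℕ}
    (y : E) (w : Fin m → E) : innerPow m y w = ∏ i, ⟪y, w i⟫ := by
  simp [innerPow]

theorem innerPow_diag {E : Type*} [NormedAddCommGroup E] [InnerProductSpace ℝ E] {m : ℕ}
    (y w : E) : (innerPow m y fun _ => w) = ⟪y, w⟫ ^ m := by
  simp [innerPow_apply]

theorem continuous_innerPow {E : Type*} [NormedAddCommGroup E] [InnerProductSpace ℝ E] (m : ℕ) :
    Continuous (innerPow m : E → E [×m]→L[ℝ] ℝ) := by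
  have h := (ContinuousMultilinearMap.compContinuousLinearMapContinuousMultilinear ℝ
    (fun _ : Fin m => E) (fun _ : Fin m => ℝ) ℝ).cont.comp
    (continuous_pi fun _ => (innerSL ℝ (E := E)).continuous)
  exact h.clm_apply continuous_const

theorem innerPow_map {E : Type*} [NormedAddCommGroup E] [InnerProductSpace ℝ E] [CompleteSpace E]
    {m : ℕ} (g : E →L[ℝ] E) (y : E) :
    innerPow m (g y) = adjointCompHom E m g (innerPow m y) := by
  ext w
  simp only [adjointCompHom_apply, innerPow_apply, ContinuousLinearMap.adjoint_inner_right]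

section Moments

variable {E : Type*} [NormedAddCommGroup E] [InnerProductSpace ℝ E] [FiniteDimensional ℝ E]
  [MeasurableSpace E] [BorelSpace E]

theorem setAverage_image_affine {V : Type*} [NormedAddCommGroup V] [NormedSpace ℝ V]
    {g : E →L[ℝ] E} (hg : Function.Injective g) (b : E) {S : Set E} (hS : MeasurableSet S)
    (F : E → V) :
    ⨍ y in (fun y => g y + b) '' S, F y = ⨍ y in S, F (g y + b) := by
  have hinj : Function.Injective fun y => g y + b := (add_left_injective b).comp hg
  have hder : ∀ y ∈ S, HasFDerivWithinAt (fun y => g y + b) g S y := fun y _ =>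
    (g.hasFDerivAt.add_const b).hasFDerivWithinAt
  have hdet : g.det ≠ 0 := by
    have : IsUnit (g : E →ₗ[ℝ] E) :=
      (LinearMap.isUnit_iff_ker_eq_bot _).2 (LinearMap.ker_eq_bot.2 hg)
    exact ((LinearMap.isUnit_iff_isUnit_det _).1 this).ne_zero
  have h1 := integral_image_eq_integral_abs_det_fderiv_smul volume hS hder hinj.injOn F
  have h2 := integral_image_eq_integral_abs_det_fderiv_smul volume hS hder hinj.injOn
    fun _ => (1 : ℝ)
  rw [integral_smul] at h1
  simp only [integral_const, measureReal_restrict_apply_univ, smul_eq_mul, mul_one] at h2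
  rw [setAverage_eq, setAverage_eq, h1, h2, smul_smul, mul_inv, mul_assoc,
    inv_mul_cancel₀ (abs_ne_zero.2 hdet), mul_one]

/-- The centroid of a set. -/
noncomputable def centroidOf (S : Set E) : E := ⨍ y in S, y

/-- The central moment form of degree `m` of a set. -/
noncomputable def centralMoment (m : ℕ) (S : Set E) : E [×m]→L[ℝ] ℝ :=
  ⨍ y in S, innerPow m (y - centroidOf S)

theorem setAverage_clm_comp {V W : Type*} [NormedAddCommGroup V] [NormedSpace ℝ V]
    [CompleteSpace V] [NormedAddCommGroup W] [NormedSpace ℝ W] [CompleteSpace W]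
    {S : Set E} (L : V →L[ℝ] W) {F : E → V} (hF : IntegrableOn F S) :
    ⨍ y in S, L (F y) = L (⨍ y in S, F y) := by
  rw [setAverage_eq, setAverage_eq, L.map_smul, L.integral_comp_comm hF]

theorem centroidOf_image_affine {g : E →L[ℝ] E} (hg : Function.Injective g) (b : E) {S : Set E}
    (hS : IsCompact S) (hS0 : volume S ≠ 0) :
    centroidOf ((fun y => g y + b) '' S) = g (centroidOf S) + b := by
  have hfin : volume S ≠ ∞ := hS.measure_lt_top.ne
  rw [centroidOf, setAverage_image_affine hg b hS.measurableSet, setAverage_eq,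
    integral_add (g.continuous.continuousOn.integrableOn_compact hS)
      (continuousOn_const.integrableOn_compact hS), smul_add, ← setAverage_eq, ← setAverage_eq,
    setAverage_const hS0 hfin,
    setAverage_clm_comp g (F := fun y => y) (continuousOn_id.integrableOn_compact hS)]
  rfl

theorem centralMoment_image_affine (m : ℕ) {g : E →L[ℝ] E} (hg : Function.Injective g) (b : E)
    {S : Set E} (hS : IsCompact S) (hS0 : volume S ≠ 0) :
    centralMoment m ((fun y => g y + b) '' S) = adjointCompHom E m g (centralMoment m S) := by
  rw [centralMoment, centroidOf_image_affine hg b hS hS0,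
    setAverage_image_affine hg b hS.measurableSet, centralMoment, ← setAverage_clm_comp]
  · simp only [add_sub_add_right_eq_sub, ← map_sub, innerPow_map]
  · exact ((continuous_innerPow m).comp (continuous_sub_right _)).continuousOn.integrableOn_compact
      hS

theorem centralMoment_apply (m : ℕ) {S : Set E} (hS : IsCompact S) (w : E) :
    (centralMoment m S fun _ => w) =
      (volume.real S)⁻¹ * ∫ y in S, ⟪y - centroidOf S, w⟫ ^ m := by
  have h := setAverage_clm_comp (S := S)
    (ContinuousMultilinearMap.apply ℝ (fun _ : Fin m => E) ℝ fun _ => w)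
    (((continuous_innerPow m).comp
      (continuous_sub_right (centroidOf S))).continuousOn.integrableOn_compact hS)
  simp only [ContinuousMultilinearMap.apply_apply, Function.comp_apply, innerPow_diag] at h
  rw [centralMoment, ← h, setAverage_eq, smul_eq_mul]

theorem centralMoment_two_pos {S : Set E} (hS : IsCompact S) (h0 : (0 : E) ∈ interior S) {w : E}
    (hw : w ≠ 0) : 0 < centralMoment 2 S fun _ => w := by
  have hS0 : 0 < volume S := Measure.measure_pos_of_mem_nhds _ (mem_interior_iff_mem_nhds.1 h0)
  have hSr : 0 < volume.real S := ENNReal.toReal_pos hS0.ne' hS.measure_lt_top.ne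
  rw [centralMoment_apply 2 hS]
  refine mul_pos (inv_pos.2 hSr) ?_
  set c := centroidOf S
  have hc : Continuous fun y => ⟪y - c, w⟫ ^ 2 := by fun_prop
  rw [setIntegral_pos_iff_support_of_nonneg_ae (Filter.Eventually.of_forall fun y => sq_nonneg _)
    (hc.continuousOn.integrableOn_compact hS)]
  refine lt_of_lt_of_le (IsOpen.measure_pos (U := (Function.support fun y => ⟪y - c, w⟫ ^ 2) ∩
    interior S) volume (hc.isOpen_support.inter isOpen_interior) ?_)
    (measure_mono (Set.inter_subset_inter_right _ interior_subset))
  by_cases h : ⟪(0 : E) - c, w⟫ = 0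
  · have h1 : Filter.Tendsto (fun t : ℝ => t • w) (nhdsWithin 0 {0}ᶜ) (nhds 0) := by
      have : Continuous fun t : ℝ => t • w := by fun_prop
      simpa using (this.tendsto 0).mono_left nhdsWithin_le_nhds
    obtain ⟨t, ht, ht0⟩ := ((h1.eventually (isOpen_interior.mem_nhds h0)).and
      self_mem_nhdsWithin).exists
    refine ⟨t • w, ?_, ht⟩
    have : ⟪t • w - c, w⟫ = t * ‖w‖ ^ 2 := by
      rw [show t • w - c = t • w + (0 - c) by abel, inner_add_left, h, inner_smul_left,
        real_inner_self_eq_norm_sq]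
      simp
    simp only [Function.mem_support, this]
    exact pow_ne_zero _ (mul_ne_zero ht0 (pow_ne_zero _ (norm_ne_zero_iff.2 hw)))
  · exact ⟨0, pow_ne_zero _ h, h0⟩

theorem continuous_setIntegral_of_ae_eventually {X V : Type*} [TopologicalSpace X] [CompactSpace X]
    [FirstCountableTopology X] [NormedAddCommGroup V] [NormedSpace ℝ V] {S : X → Set E} {R : ℝ}
    (hS : ∀ x, MeasurableSet (S x)) (hSR : ∀ x, S x ⊆ closedBall 0 R)
    (hae : ∀ x, ∀ᵐ y, ∀ᶠ z in nhds x, (y ∈ S z ↔ y ∈ S x)) {F : X → E → V}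
    (hF : Continuous fun p : X × E => F p.1 p.2) : Continuous fun x => ∫ y in S x, F x y := by
  have hK : IsCompact ((Set.univ : Set X) ×ˢ closedBall (0 : E) R) :=
    isCompact_univ.prod (isCompact_closedBall 0 R)
  obtain ⟨A, hA⟩ := hK.exists_bound_of_continuousOn hF.continuousOn
  have h1 : ∀ x, ∫ y in S x, F x y = ∫ y in closedBall 0 R, (S x).indicator (F x) y := by
    intro x
    rw [setIntegral_indicator (hS x), Set.inter_eq_self_of_subset_right (hSR x)]
  simp only [h1]
  refine continuous_iff_continuousAt.2 fun x => ?_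
  refine continuousAt_of_dominated (bound := fun _ => |A|) ?_ ?_ ?_ ?_
  · refine Filter.Eventually.of_forall fun z => ?_
    exact ((hF.comp (Continuous.prodMk_right z)).aestronglyMeasurable).indicator (hS z)
  · refine Filter.Eventually.of_forall fun z => ?_
    filter_upwards [ae_restrict_mem measurableSet_closedBall] with y hy
    by_cases h : y ∈ S z
    · rw [Set.indicator_of_mem h]
      exact (hA (z, y) ⟨trivial, hy⟩).trans (le_abs_self A)
    · rw [Set.indicator_of_notMem h, norm_zero]
      exact abs_nonneg A
  · exact continuousOn_const.integrableOn_compact (isCompact_closedBall 0 R)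
  · filter_upwards [ae_restrict_of_ae (hae x)] with y hy
    by_cases h : y ∈ S x
    · have : (fun z => F z y) =ᶠ[nhds x] fun z => (S z).indicator (F z) y := by
        filter_upwards [hy] with z hz
        rw [Set.indicator_of_mem (hz.2 h)]
      exact ContinuousAt.congr (hF.comp (Continuous.prodMk_left y)).continuousAt this
    · have : (fun _ => 0) =ᶠ[nhds x] fun z => (S z).indicator (F z) y := by
        filter_upwards [hy] with z hz
        rw [Set.indicator_of_notMem (fun h' => h (hz.1 h'))]
      exact continuousAt_const.congr this

theorem continuous_setAverage_of_ae_eventually {X V : Type*} [TopologicalSpace X] [CompactSpace X]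
    [FirstCountableTopology X] [NormedAddCommGroup V] [NormedSpace ℝ V] {S : X → Set E} {R : ℝ}
    (hS : ∀ x, MeasurableSet (S x)) (hSR : ∀ x, S x ⊆ closedBall 0 R)
    (hS0 : ∀ x, volume (S x) ≠ 0)
    (hae : ∀ x, ∀ᵐ y, ∀ᶠ z in nhds x, (y ∈ S z ↔ y ∈ S x)) {F : X → E → V}
    (hF : Continuous fun p : X × E => F p.1 p.2) : Continuous fun x => ⨍ y in S x, F x y := by
  simp only [setAverage_eq]
  refine Continuous.smul (Continuous.inv₀ ?_ fun x => ?_)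
    (continuous_setIntegral_of_ae_eventually hS hSR hae hF)
  · have := continuous_setIntegral_of_ae_eventually hS hSR hae (F := fun _ _ => (1 : ℝ))
      continuous_const
    simpa using this
  · exact (ENNReal.toReal_pos (hS0 x)
      (((measure_mono (hSR x)).trans_lt measure_closedBall_lt_top).ne)).ne'

theorem continuous_centralMoment {X : Type*} [TopologicalSpace X] [CompactSpace X]
    [FirstCountableTopology X] {S : X → Set E} {R : ℝ}
    (hS : ∀ x, MeasurableSet (S x)) (hSR : ∀ x, S x ⊆ closedBall 0 R)
    (hS0 : ∀ x, volume (S x) ≠ 0)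
    (hae : ∀ x, ∀ᵐ y, ∀ᶠ z in nhds x, (y ∈ S z ↔ y ∈ S x)) (m : ℕ) :
    Continuous fun x => centralMoment m (S x) := by
  have hc : Continuous fun x => centroidOf (S x) :=
    continuous_setAverage_of_ae_eventually hS hSR hS0 hae continuous_snd
  exact continuous_setAverage_of_ae_eventually hS hSR hS0 hae
    ((continuous_innerPow m).comp (continuous_snd.sub (hc.comp continuous_fst)))

end Moments

section Cylinder

variable {E : Type*} [NormedAddCommGroup E] [InnerProductSpace ℝ E]

/-- The orthogonal cylinder of height two over the section of `B` by the hyperplane `uᗮ`. -/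
def sectionCylinder (B : Set E) (u : E) : Set E := {y | y - ⟪y, u⟫ • u ∈ B ∧ |⟪y, u⟫| ≤ 1}

theorem sectionCylinder_neg (B : Set E) (u : E) :
    sectionCylinder B (-u) = sectionCylinder B u := by
  simp [sectionCylinder]

theorem isClosed_sectionCylinder {B : Set E} (hB : IsClosed B) (u : E) :
    IsClosed (sectionCylinder B u) :=
  (hB.preimage (by fun_prop : Continuous fun y : E => y - ⟪y, u⟫ • u)).inter
    (isClosed_le (by fun_prop : Continuous fun y : E => |⟪y, u⟫|) continuous_const)

theorem convex_sectionCylinder {B : Set E} (hB : Convex ℝ B) (u : E) :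
    Convex ℝ (sectionCylinder B u) := by
  intro x hx y hy a b ha hb hab
  constructor
  · have := hB hx.1 hy.1 ha hb hab
    rwa [show a • x + b • y - ⟪a • x + b • y, u⟫ • u =
      a • (x - ⟪x, u⟫ • u) + b • (y - ⟪y, u⟫ • u) by
      rw [inner_add_left, real_inner_smul_left, real_inner_smul_left]
      module]
  · rw [inner_add_left, real_inner_smul_left, real_inner_smul_left]
    have h1 := abs_le.1 hx.2
    have h2 := abs_le.1 hy.2
    exact abs_le.2 ⟨by nlinarith, by nlinarith⟩

theorem sectionCylinder_subset_closedBall {B : Set E} {R : ℝ} (hR : B ⊆ closedBall 0 R) {u : E}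
    (hu : ‖u‖ = 1) : sectionCylinder B u ⊆ closedBall 0 (R + 1) := by
  intro y hy
  have h1 := mem_closedBall_zero_iff.1 (hR hy.1)
  rw [mem_closedBall_zero_iff]
  calc ‖y‖ = ‖(y - ⟪y, u⟫ • u) + ⟪y, u⟫ • u‖ := by rw [sub_add_cancel]
    _ ≤ ‖y - ⟪y, u⟫ • u‖ + ‖⟪y, u⟫ • u‖ := norm_add_le _ _
    _ ≤ R + 1 := by
      refine add_le_add h1 ?_
      rw [norm_smul, hu, mul_one]
      exact hy.2

theorem zero_mem_interior_sectionCylinder {B : Set E} (hB : (0 : E) ∈ interior B) (u : E) :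
    (0 : E) ∈ interior (sectionCylinder B u) := by
  refine mem_interior.2 ⟨{y | y - ⟪y, u⟫ • u ∈ interior B} ∩ {y | |⟪y, u⟫| < 1},
    fun y hy => ⟨interior_subset hy.1, le_of_lt hy.2⟩, ?_, by simpa using hB⟩
  exact (isOpen_interior.preimage (by fun_prop : Continuous fun y : E => y - ⟪y, u⟫ • u)).inter
    (isOpen_lt (by fun_prop : Continuous fun y : E => |⟪y, u⟫|) continuous_const)

theorem Convex.mem_interior_of_smul_mem {B : Set E} (hB : Convex ℝ B) (h0 : (0 : E) ∈ interior B)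
    {s : ℝ} (hs : 1 < s) {x : E} (hx : s • x ∈ B) : x ∈ interior B := by
  refine hB.openSegment_interior_self_subset_interior h0 hx ?_
  have hs0 : 0 < s := one_pos.trans hs
  refine ⟨1 - s⁻¹, s⁻¹, sub_pos.2 (inv_lt_one_of_one_lt₀ hs), inv_pos.2 hs0, by ring, ?_⟩
  rw [smul_zero, zero_add, smul_smul, inv_mul_cancel₀ hs0.ne', one_smul]

theorem mem_interior_of_mem_interior_sectionCylinder {B : Set E} (hB : Convex ℝ B)
    (h0 : (0 : E) ∈ interior B) {u y : E} (hy : y ∈ interior (sectionCylinder B u)) :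
    y - ⟪y, u⟫ • u ∈ interior B ∧ |⟪y, u⟫| < 1 := by
  have h1 : Filter.Tendsto (fun s : ℝ => s • y) (nhdsWithin 1 (Set.Ioi 1)) (nhds y) := by
    have : Continuous fun s : ℝ => s • y := by fun_prop
    simpa using (this.tendsto 1).mono_left nhdsWithin_le_nhds
  obtain ⟨s, hs, hs1⟩ := ((h1.eventually (mem_interior_iff_mem_nhds.1 hy)).and
    self_mem_nhdsWithin).exists
  have hs1 : 1 < s := hs1
  obtain ⟨h2, h3⟩ := hs
  rw [real_inner_smul_left, mul_smul, ← smul_sub] at h2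
  rw [real_inner_smul_left, abs_mul, abs_of_pos (one_pos.trans hs1)] at h3
  refine ⟨hB.mem_interior_of_smul_mem h0 hs1 h2, ?_⟩
  nlinarith [abs_nonneg ⟪y, u⟫]

theorem ae_eventually_mem_sectionCylinder_iff [FiniteDimensional ℝ E] [MeasurableSpace E]
    [BorelSpace E] {B : Set E} (hB : Convex ℝ B) (hBc : IsClosed B) (h0 : (0 : E) ∈ interior B)
    (u : E) : ∀ᵐ y, ∀ᶠ v in nhds u, (y ∈ sectionCylinder B v ↔ y ∈ sectionCylinder B u) := by
  have hnull := (convex_sectionCylinder hB u).addHaar_frontier volume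
  filter_upwards [measure_eq_zero_iff_ae_notMem.1 hnull] with y hy
  have hc1 : Continuous fun v : E => y - ⟪y, v⟫ • v := by fun_prop
  have hc2 : Continuous fun v : E => |⟪y, v⟫| := by fun_prop
  by_cases h : y ∈ sectionCylinder B u
  · have hi : y ∈ interior (sectionCylinder B u) := by
      by_contra h'
      exact hy ⟨subset_closure h, h'⟩
    obtain ⟨h1, h2⟩ := mem_interior_of_mem_interior_sectionCylinder hB h0 hi
    filter_upwards [hc1.continuousAt.eventually_mem (isOpen_interior.mem_nhds h1),
      hc2.continuousAt.eventually_lt continuousAt_const h2] with v hv1 hv2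
    exact ⟨fun _ => h, fun _ => ⟨interior_subset hv1, hv2.le⟩⟩
  · by_cases h1 : y - ⟪y, u⟫ • u ∈ B
    · have h2 : 1 < |⟪y, u⟫| := by
        by_contra h2
        exact h ⟨h1, not_lt.1 h2⟩
      filter_upwards [continuousAt_const.eventually_lt hc2.continuousAt h2] with v hv
      exact ⟨fun h' => absurd h'.2 (not_le.2 hv), fun h' => absurd h' h⟩
    · filter_upwards [hc1.continuousAt.eventually_mem (hBc.isOpen_compl.mem_nhds h1)] with v hv
      exact ⟨fun h' => absurd h'.1 hv, fun h' => absurd h' h⟩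

theorem exists_affine_image_sectionCylinder [FiniteDimensional ℝ E] {B : Set E}
    (h0 : (0 : E) ∈ interior B) {u v : E} (hu : ‖u‖ = 1) (hv : ‖v‖ = 1) {f : E ≃ᵃ[ℝ] E}
    (hf : f '' (B ∩ {x | ⟪x, u⟫ = 0}) = B ∩ {x | ⟪x, v⟫ = 0}) :
    ∃ (g : E →L[ℝ] E) (b : E), Function.Injective g ∧ g u = v ∧
      (fun y => g y + b) '' sectionCylinder B u = sectionCylinder B v := by
  have huu : ⟪u, u⟫ = 1 := by rw [real_inner_self_eq_norm_sq, hu, one_pow]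
  have hvv : ⟪v, v⟫ = 1 := by rw [real_inner_self_eq_norm_sq, hv, one_pow]
  let A : E →L[ℝ] E := LinearMap.toContinuousLinearMap (f.linear : E →ₗ[ℝ] E)
  have hfA : ∀ x, f x = A x + f 0 := fun x => by
    have : f x = f.linear x + f 0 := by simpa using f.map_vadd 0 x
    exact this
  have hAinj : Function.Injective A := f.linear.injective
  have hb : ⟪f 0, v⟫ = 0 := by
    have : f 0 ∈ B ∩ {x | ⟪x, v⟫ = 0} := hf ▸ Set.mem_image_of_mem f
      ⟨interior_subset h0, inner_zero_left u⟩
    exact this.2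
  have hA : ∀ x, ⟪x, u⟫ = 0 → ⟪A x, v⟫ = 0 := by
    intro x hx
    have h1 : Filter.Tendsto (fun t : ℝ => t • x) (nhdsWithin 0 {0}ᶜ) (nhds 0) := by
      have : Continuous fun t : ℝ => t • x := by fun_prop
      simpa using (this.tendsto 0).mono_left nhdsWithin_le_nhds
    obtain ⟨t, ht, ht0⟩ := ((h1.eventually (mem_interior_iff_mem_nhds.1 h0)).and
      self_mem_nhdsWithin).exists
    have h2 : f (t • x) ∈ B ∩ {x | ⟪x, v⟫ = 0} := hf ▸ Set.mem_image_of_mem f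
      ⟨ht, by simp [real_inner_smul_left, hx]⟩
    have h3 : ⟪f (t • x), v⟫ = 0 := h2.2
    rw [hfA, inner_add_left, hb, add_zero, map_smul, real_inner_smul_left] at h3
    exact (mul_eq_zero.1 h3).resolve_left ht0
  have hproj : ∀ y, ⟪y - ⟪y, u⟫ • u, u⟫ = 0 := fun y => by
    rw [inner_sub_left, real_inner_smul_left, huu, mul_one, sub_self]
  let g : E →L[ℝ] E := A ∘L (ContinuousLinearMap.id ℝ E - (innerSL ℝ u).smulRight u) +
    (innerSL ℝ u).smulRight v
  have hg : ∀ y, g y = A (y - ⟪y, u⟫ • u) + ⟪y, u⟫ • v := fun y => by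
    simp [g, real_inner_comm]
  have hgv : ∀ y, ⟪g y, v⟫ = ⟪y, u⟫ := fun y => by
    rw [hg, inner_add_left, hA _ (hproj y), real_inner_smul_left, hvv, mul_one, zero_add]
  have hginj : Function.Injective g := by
    refine (injective_iff_map_eq_zero g).2 fun y hy => ?_
    have h1 := hgv y
    rw [hy, inner_zero_left] at h1
    have h2 := hg y
    rw [hy, ← h1, zero_smul, zero_smul, sub_zero, add_zero] at h2
    exact (map_eq_zero_iff A hAinj).1 h2.symm
  refine ⟨g, f 0, hginj, ?_, ?_⟩
  · rw [hg, huu, one_smul, one_smul, sub_self, map_zero, zero_add]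
  · have hiff : ∀ y, g y + f 0 ∈ sectionCylinder B v ↔ y ∈ sectionCylinder B u := by
      intro y
      have h1 : ⟪g y + f 0, v⟫ = ⟪y, u⟫ := by rw [inner_add_left, hgv, hb, add_zero]
      have h2 : g y + f 0 - ⟪y, u⟫ • v = f (y - ⟪y, u⟫ • u) := by
        rw [hfA (y - ⟪y, u⟫ • u), hg]
        abel
      simp only [sectionCylinder, Set.mem_ofPred_eq, h1, h2]
      refine and_congr_left fun _ => ⟨fun h => ?_, fun h => ?_⟩
      · have h3 : f (y - ⟪y, u⟫ • u) ∈ f '' (B ∩ {x | ⟪x, u⟫ = 0}) := by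
          rw [hf]
          refine ⟨h, ?_⟩
          rw [Set.mem_ofPred_eq, hfA, inner_add_left, hb, hA _ (hproj y), add_zero]
        obtain ⟨q, hq, hq'⟩ := h3
        rw [← f.injective hq']
        exact hq.1
      · have h3 : f (y - ⟪y, u⟫ • u) ∈ B ∩ {x | ⟪x, v⟫ = 0} :=
          hf ▸ Set.mem_image_of_mem f ⟨h, hproj y⟩
        exact h3.1
    have hsurj : Function.Surjective g := (LinearMap.injective_iff_surjective
      (f := (g : E →ₗ[ℝ] E))).1 hginj
    refine Set.Subset.antisymm ?_ fun z hz => ?_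
    · rintro _ ⟨y, hy, rfl⟩
      exact (hiff y).2 hy
    · obtain ⟨y, hy⟩ := hsurj (z - f 0)
      have h1 : g y + f 0 = z := by rw [hy, sub_add_cancel]
      exact ⟨y, (hiff y).1 (h1 ▸ hz), h1⟩

end Cylinder

section Sections

variable {E : Type*} [NormedAddCommGroup E] [InnerProductSpace ℝ E] [FiniteDimensional ℝ E]
  [MeasurableSpace E] [BorelSpace E]

theorem exists_reflection_of_odd_moments {B : Set E} (hBc : IsCompact B) (hB : Convex ℝ B)
    (h0 : (0 : E) ∈ interior B) {u : E} (hu : ‖u‖ = 1)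
    (hodd : ∀ m, Odd m → ∀ w, ⟪u, w⟫ = 0 →
      (centralMoment m (sectionCylinder B u) fun _ => w) = 0) :
    ∃ c, ⟪c, u⟫ = 0 ∧ ∀ x ∈ B, ⟪x, u⟫ = 0 → (2 : ℝ) • c - x ∈ B := by
  have huu : ⟪u, u⟫ = 1 := by rw [real_inner_self_eq_norm_sq, hu, one_pow]
  obtain ⟨R, hR⟩ := hBc.isBounded.subset_closedBall 0
  set S := sectionCylinder B u
  have hScl : IsClosed S := isClosed_sectionCylinder hBc.isClosed u
  have hSR : S ⊆ closedBall 0 (R + 1) := sectionCylinder_subset_closedBall hR hu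
  have hSc : IsCompact S := (isCompact_closedBall 0 (R + 1)).of_isClosed_subset hScl hSR
  have hSi : (0 : E) ∈ interior S := zero_mem_interior_sectionCylinder h0 u
  have hS0 : 0 < volume S := Measure.measure_pos_of_mem_nhds _ (mem_interior_iff_mem_nhds.1 hSi)
  have hSr : 0 < volume.real S := ENNReal.toReal_pos hS0.ne' hSc.measure_lt_top.ne
  have : IsFiniteMeasure (volume.restrict S) := ⟨by simpa using hSc.measure_lt_top⟩
  let π : E → E := fun y => y - ⟪y, u⟫ • u
  have hπ : Continuous π := by fun_prop
  have hπu : ∀ y, ⟪π y, u⟫ = 0 := fun y => by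
    rw [inner_sub_left, real_inner_smul_left, huu, mul_one, sub_self]
  have hππ : ∀ y w, ⟪π y, w⟫ = ⟪y, π w⟫ := fun y w => by
    simp only [π, inner_sub_left, inner_sub_right, real_inner_smul_left, real_inner_smul_right,
      real_inner_comm w u]
    ring
  have hπid : ∀ y, ⟪y, u⟫ = 0 → π y = y := fun y hy => by simp [π, hy]
  set c := centroidOf S
  let φ : E → E := fun y => π y - π c
  have hφ : Continuous φ := hπ.sub continuous_const
  have hφw : ∀ y w, ⟪φ y, w⟫ = ⟪y - c, π w⟫ := fun y w => by
    simp only [φ, inner_sub_left, hππ]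
  let ν : Measure E := (volume.restrict S).map φ
  have hbd : ∀ y ∈ S, ‖φ y‖ ≤ R + ‖π c‖ := fun y hy =>
    (norm_sub_le _ _).trans (add_le_add_left (mem_closedBall_zero_iff.1 (hR hy.1)) _)
  have hmom : ∀ w k, ∫ z, ⟪z, w⟫ ^ k ∂ν = ∫ y in S, ⟪y - c, π w⟫ ^ k := fun w k => by
    rw [integral_map hφ.aemeasurable (by fun_prop : Continuous _).aestronglyMeasurable]
    simp only [hφw]
  have hneg : ν = ν.map Neg.neg := by
    have hνbd : ∀ᵐ z ∂ν, ‖z‖ ≤ R + ‖π c‖ := by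
      rw [ae_map_iff hφ.aemeasurable (measurableSet_le measurable_norm measurable_const)]
      filter_upwards [ae_restrict_mem hScl.measurableSet] with y hy using hbd y hy
    refine measure_ext_of_inner_pow_moments (R + ‖π c‖) hνbd ?_ fun w k => ?_
    · rw [ae_map_iff measurable_neg.aemeasurable
        (measurableSet_le measurable_norm measurable_const)]
      simpa only [norm_neg] using hνbd
    · rw [integral_map measurable_neg.aemeasurable
        (by fun_prop : Continuous _).aestronglyMeasurable]
      simp only [inner_neg_left]
      rcases Nat.even_or_odd k with hk | hk
      · simp only [hk.neg_pow]
      · simp only [hk.neg_pow]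
        have h1 := hodd k hk (π w) (by rw [real_inner_comm, hπu])
        rw [centralMoment_apply k hSc] at h1
        rw [integral_neg, hmom, (mul_eq_zero.1 h1).resolve_left (inv_pos.2 hSr).ne', neg_zero]
  refine ⟨π c, hπu c, fun x hx hxu => ?_⟩
  by_contra hq
  obtain ⟨r, hr, hball⟩ := Metric.isOpen_iff.1 hBc.isClosed.isOpen_compl _ hq
  have h1 : ν (ball (π c - x) r) = 0 := by
    rw [Measure.map_apply hφ.measurable measurableSet_ball,
      Measure.restrict_apply (hφ.measurable measurableSet_ball)]
    refine measure_mono_null (t := ∅) ?_ measure_empty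
    rintro y ⟨hy, hyS⟩
    refine hball ?_ hyS.1
    rw [Set.mem_preimage, mem_ball_iff_norm] at hy
    rw [mem_ball_iff_norm]
    convert hy using 2
    simp only [φ, π]
    module
  have h2 : 0 < ν (ball (x - π c) r) := by
    rw [Measure.map_apply hφ.measurable measurableSet_ball,
      Measure.restrict_apply (hφ.measurable measurableSet_ball)]
    refine lt_of_lt_of_le (IsOpen.measure_pos (U := φ ⁻¹' ball (x - π c) r ∩ interior S) volume
      ((isOpen_ball.preimage hφ).inter isOpen_interior) ?_)
      (measure_mono (Set.inter_subset_inter_right _ interior_subset))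
    have hxS : x ∈ closure (interior S) := by
      rw [(convex_sectionCylinder hB u).closure_interior_eq_closure_of_nonempty_interior ⟨0, hSi⟩]
      refine subset_closure ⟨?_, ?_⟩
      · rwa [hxu, zero_smul, sub_zero]
      · simp [hxu]
    refine mem_closure_iff.1 hxS _ (isOpen_ball.preimage hφ) ?_
    simp only [Set.mem_preimage, φ, hπid x hxu]
    exact mem_ball_self hr
  rw [hneg, Measure.map_apply measurable_neg measurableSet_ball] at h2
  refine h2.ne' ?_
  convert h1 using 2
  ext z
  rw [Set.mem_preimage, mem_ball_iff_norm, mem_ball_iff_norm, ← norm_neg]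
  congr! 2
  abel

theorem exists_reflection_of_affinely_equivalent_sections [Nontrivial E] {B : Set E}
    (hBc : IsCompact B) (hB : Convex ℝ B) (h0 : (0 : E) ∈ interior B)
    (hsec : ∀ u v : E, ‖u‖ = 1 → ‖v‖ = 1 → ∃ f : E ≃ᵃ[ℝ] E,
      f '' (B ∩ {x | ⟪x, u⟫ = 0}) = B ∩ {x | ⟪x, v⟫ = 0}) {u : E} (hu : ‖u‖ = 1) :
    ∃ c, ⟪c, u⟫ = 0 ∧ ∀ x ∈ B, ⟪x, u⟫ = 0 → (2 : ℝ) • c - x ∈ B := by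
  obtain ⟨R, hR⟩ := hBc.isBounded.subset_closedBall 0
  let S : sphere (0 : E) 1 → Set E := fun v => sectionCylinder B v
  have hnorm : ∀ v : sphere (0 : E) 1, ‖(v : E)‖ = 1 := fun v => mem_sphere_zero_iff_norm.1 v.2
  have hScl : ∀ v, IsClosed (S v) := fun v => isClosed_sectionCylinder hBc.isClosed v
  have hSR : ∀ v, S v ⊆ closedBall 0 (R + 1) := fun v =>
    sectionCylinder_subset_closedBall hR (hnorm v)
  have hSc : ∀ v, IsCompact (S v) := fun v =>
    (isCompact_closedBall 0 (R + 1)).of_isClosed_subset (hScl v) (hSR v)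
  have hSi : ∀ v, (0 : E) ∈ interior (S v) := fun v => zero_mem_interior_sectionCylinder h0 v
  have hS0 : ∀ v, volume (S v) ≠ 0 := fun v =>
    (Measure.measure_pos_of_mem_nhds _ (mem_interior_iff_mem_nhds.1 (hSi v))).ne'
  have hae : ∀ v, ∀ᵐ y, ∀ᶠ z in nhds v, (y ∈ S z ↔ y ∈ S v) := fun v => by
    filter_upwards [ae_eventually_mem_sectionCylinder_iff hB hBc.isClosed h0 (v : E)] with y hy
    exact continuous_subtype_val.continuousAt.eventually hy
  have hcont : ∀ m, Continuous fun v => centralMoment m (S v) := fun m =>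
    continuous_centralMoment (fun v => (hScl v).measurableSet) hSR hS0 hae m
  have hnonpos : ∀ m, Odd m → ∀ w, ⟪u, w⟫ = 0 →
      (centralMoment m (sectionCylinder B u) fun _ => w) ≤ 0 := by
    intro m hm w hw
    refine forall_odd_form_nonpos_of_transitive hm (hcont 2)
      (fun v w hw => centralMoment_two_pos (hSc v) (hSi v) hw) (hcont m) (fun v => ?_)
      (fun v v' => ?_) ⟨u, mem_sphere_zero_iff_norm.2 hu⟩ w hw
    · exact congrArg (centralMoment m) (sectionCylinder_neg B (v : E))
    · obtain ⟨f, hf⟩ := hsec v v' (hnorm v) (hnorm v')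
      obtain ⟨g, b, hg, hgv, himg⟩ :=
        exists_affine_image_sectionCylinder h0 (hnorm v) (hnorm v') hf
      have h : ∀ k, centralMoment k (S v') = adjointCompHom E k g (centralMoment k (S v)) :=
        fun k => by
          rw [← centralMoment_image_affine k hg b (hSc v) (hS0 v)]
          exact congrArg (centralMoment k) himg.symm
      exact ⟨g, hgv, fun w => by rw [h, adjointCompHom_apply],
        fun w => by rw [h, adjointCompHom_apply]⟩
  refine exists_reflection_of_odd_moments hBc hB h0 hu fun m hm w hw => ?_
  refine le_antisymm (hnonpos m hm w hw) ?_
  have h1 := hnonpos m hm ((-1 : ℝ) • w) (by rw [real_inner_smul_right, hw, mul_zero])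
  have h2 := (centralMoment m (sectionCylinder B u)).map_smul_univ (fun _ => (-1 : ℝ)) fun _ => w
  rw [h2] at h1
  simp only [Finset.prod_const, Finset.card_univ, Fintype.card_fin, hm.neg_one_pow,
    smul_eq_mul] at h1
  linarith

end Sections

end Auxiliary

/-- if all hyperplane sections through the origin of a convex body `B ⊆ ℝ^{n+1}`
are affinely equivalent, then every hyperplane section of `B` through the origin is
centrally symmetric. -/
theorem affinely_equivalent_central_sections_implies_symmetric_sections
    (n : ℕ) (hn : 2 ≤ n)
    (B : Set (EuclideanSpace ℝ (Fin (n + 1))))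
    (hBcompact : IsCompact B) (hBconv : Convex ℝ B)
    (hB0 : (0 : EuclideanSpace ℝ (Fin (n + 1))) ∈ interior B)
    (hsec : ∀ H₁ H₂ : Submodule ℝ (EuclideanSpace ℝ (Fin (n + 1))),
      Module.finrank ℝ H₁ = n → Module.finrank ℝ H₂ = n →
        ∃ f : EuclideanSpace ℝ (Fin (n + 1)) ≃ᵃ[ℝ] EuclideanSpace ℝ (Fin (n + 1)),
          f '' (B ∩ (H₁ : Set (EuclideanSpace ℝ (Fin (n + 1))))) =
            B ∩ (H₂ : Set (EuclideanSpace ℝ (Fin (n + 1))))) :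
    ∀ H : Submodule ℝ (EuclideanSpace ℝ (Fin (n + 1))), Module.finrank ℝ H = n →
      ∃ c : EuclideanSpace ℝ (Fin (n + 1)), c ∈ H ∧
        B ∩ (H : Set (EuclideanSpace ℝ (Fin (n + 1)))) =
          (fun x => (2 : ℝ) • c - x) '' (B ∩ (H : Set (EuclideanSpace ℝ (Fin (n + 1))))) := by
  intro H hH
  have hdim : Fact (Module.finrank ℝ (EuclideanSpace ℝ (Fin (n + 1))) = n + 1) :=
    ⟨finrank_euclideanSpace_fin⟩
  have hperp : ∀ u : EuclideanSpace ℝ (Fin (n + 1)),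
      (((ℝ ∙ u)ᗮ : Submodule ℝ _) : Set (EuclideanSpace ℝ (Fin (n + 1)))) =
        {x | inner ℝ x u = 0} := fun u =>
    Set.ext fun x => Submodule.mem_orthogonal_singleton_iff_inner_left
  have hfin : ∀ u : EuclideanSpace ℝ (Fin (n + 1)), ‖u‖ = 1 →
      Module.finrank ℝ (ℝ ∙ u)ᗮ = n := fun u hu =>
    Submodule.finrank_orthogonal_span_singleton (norm_ne_zero_iff.1 (hu ▸ one_ne_zero))
  obtain ⟨u, hu, hHu⟩ : ∃ u : EuclideanSpace ℝ (Fin (n + 1)), ‖u‖ = 1 ∧ H = (ℝ ∙ u)ᗮ := by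
    have hbot : Hᗮ ≠ ⊥ := by
      intro h
      have h1 := H.finrank_add_finrank_orthogonal
      rw [h, finrank_bot, hH, hdim.out] at h1
      omega
    obtain ⟨v, hv, hv0⟩ := Submodule.exists_mem_ne_zero_of_ne_bot hbot
    have hu : ‖(‖v‖⁻¹ : ℝ) • v‖ = 1 := norm_smul_inv_norm (𝕜 := ℝ) hv0
    refine ⟨(‖v‖⁻¹ : ℝ) • v, hu, Submodule.eq_of_le_of_finrank_eq ?_ (by rw [hH, hfin _ hu])⟩
    exact H.le_orthogonal_orthogonal.trans (Submodule.orthogonal_le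
      ((Submodule.span_singleton_le_iff_mem _ _).2 (Hᗮ.smul_mem _ hv)))
  obtain ⟨c, hcu, hc⟩ := exists_reflection_of_affinely_equivalent_sections hBcompact hBconv hB0
    (fun u v hu hv => by
      obtain ⟨f, hf⟩ := hsec _ _ (hfin u hu) (hfin v hv)
      exact ⟨f, by rwa [hperp, hperp] at hf⟩) hu
  rw [hHu]
  have hmem : ∀ x ∈ B ∩ ((ℝ ∙ u)ᗮ : Submodule ℝ (EuclideanSpace ℝ (Fin (n + 1)))),
      (2 : ℝ) • c - x ∈ B ∩ ((ℝ ∙ u)ᗮ : Submodule ℝ (EuclideanSpace ℝ (Fin (n + 1)))) := by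
    intro x hx
    rw [hperp] at hx ⊢
    have hxu : inner ℝ x u = 0 := hx.2
    exact ⟨hc x hx.1 hxu, by
      simp only [Set.mem_ofPred_eq, inner_sub_left, real_inner_smul_left, hcu, hxu, mul_zero,
        sub_zero]⟩
  refine ⟨c, Submodule.mem_orthogonal_singleton_iff_inner_left.2 hcu,
    Set.Subset.antisymm (fun x hx => ⟨_, hmem x hx, sub_sub_cancel _ _⟩) ?_⟩
  rintro _ ⟨x, hx, rfl⟩
  exact hmem x hx
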